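/- Let t = 2t'+1 be an odd positive integer and b a complex number. Then Σ_{λ ∈ SC} δ_λ x^{|λ|} ∏_{h ∈ H_t(λ)} bt/(h ε_h) = exp(-b x^t - t b² x^{2t}/2) · ∏_{k≥1} [(1-x^k)/(1-x^{2k})] · (1-x^{2kt})^{t'} · [(1-x^{2kt})/(1-x^{kt})], as formal power series in x over ℂ, where the sum ranges over all self-conjugate partitions. -/

import Mathlib

/-!
Statement 16 (Corollary `funexppair`, odd case): for `t = 2t'+1` an odd positive
integer and a complex number `b`,
Σ_{λ ∈ SC} δ_λ x^{|λ|} ∏_{h ∈ H_t(λ)} bt/(h ε_h)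
  = exp(-b x^t - t b² x^{2t}/2)
      · ∏_{k≥1} [(1-x^k)/(1-x^{2k})] · (1-x^{2kt})^{t'} · [(1-x^{2kt})/(1-x^{kt})],
as formal power series over ℂ, the sum ranging over self-conjugate partitions.
-/

noncomputable section

open PowerSeries

/-- Product (pi) topology on formal power series. -/
instance {R : Type*} [TopologicalSpace R] : TopologicalSpace (PowerSeries R) :=
  inferInstanceAs (TopologicalSpace ((Unit →₀ ℕ) → R))

/-- The hook length of the box `c = (i, j)` (0-indexed) of a Young diagram. -/
def hookLen (μ : YoungDiagram) (c : ℕ × ℕ) : ℕ :=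
  μ.rowLen c.1 + μ.colLen c.2 - c.1 - c.2 - 1

/-- The Durfee length: the number of diagonal cells. -/
def durfee (μ : YoungDiagram) : ℕ :=
  (μ.cells.filter fun c => c.1 = c.2).card

/-- `ε` of a box: `-1` if strictly above the principal diagonal, `1` otherwise. -/
def eps (c : ℕ × ℕ) : ℂ := if c.2 < c.1 then (-1 : ℂ) else 1

/-- The formal exponential `exp f = Σ_k f^k / k!` of a power series. -/
def pexp (f : PowerSeries ℂ) : PowerSeries ℂ :=
  ∑' k : ℕ, PowerSeries.C ((k.factorial : ℂ))⁻¹ * f ^ k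

section
open Polynomial in
theorem downPoly {ι : Type*} [DecidableEq ι] (x : ι → ℂ) (s : Finset ι) :
    (Polynomial.X * ∏ j ∈ s, (Polynomial.X - Polynomial.C (1 + x j)) - (Polynomial.X - Polynomial.C (s.card : ℂ)) * ∏ j ∈ s, (Polynomial.X - Polynomial.C (x j))).degree
        < (s.card : WithBot ℕ) ∧
    ∀ k, k + 1 = s.card →
    (Polynomial.X * ∏ j ∈ s, (Polynomial.X - Polynomial.C (1 + x j)) - (Polynomial.X - Polynomial.C (s.card : ℂ)) * ∏ j ∈ s, (Polynomial.X - Polynomial.C (x j))).coeff k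
      = (s.card.choose 2 : ℂ) - ∑ i ∈ s, x i := by
  induction s using Finset.induction_on with
  | empty => simp
  | insert a s ha ih =>
    obtain ⟨h1, h2⟩ := ih
    set R := (Polynomial.X * ∏ j ∈ s, (Polynomial.X - Polynomial.C (1 + x j)) - (Polynomial.X - Polynomial.C (s.card : ℂ)) * ∏ j ∈ s, (Polynomial.X - Polynomial.C (x j)))
      with hR
    set Q := ∏ j ∈ s, (Polynomial.X - Polynomial.C (x j)) with hQ
    have hQd : Q.degree = s.card := by
      rw [hQ, degree_prod]; simp
    have hQm : Q.Monic := monic_prod_of_monic _ _ (fun j _ => monic_X_sub_C _)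
    have hQn : Q.natDegree = s.card := natDegree_eq_of_degree_eq_some hQd
    have key : Polynomial.X * ∏ j ∈ insert a s, (Polynomial.X - Polynomial.C (1 + x j)) -
        (Polynomial.X - Polynomial.C ((insert a s).card : ℂ)) * ∏ j ∈ insert a s, (Polynomial.X - Polynomial.C (x j))
        = (Polynomial.X - Polynomial.C (1 + x a)) * R + Polynomial.C ((s.card : ℂ) - x a) * Q := by
      rw [Finset.prod_insert ha, Finset.prod_insert ha, Finset.card_insert_of_notMem ha, hR, hQ]
      push_cast
      simp only [C_add, C_sub, C_1]
      ring
    rw [key, Finset.card_insert_of_notMem ha]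
    constructor
    · refine lt_of_le_of_lt (degree_add_le _ _) (max_lt ?_ ?_)
      · rw [degree_mul, degree_X_sub_C]
        push_cast
        rw [add_comm]
        by_cases hR0 : R = 0
        · simp [hR0]
        · rw [degree_eq_natDegree hR0] at h1 ⊢
          norm_cast at h1 ⊢
          omega
      · rw [C_mul']
        refine lt_of_le_of_lt (degree_smul_le _ _) ?_
        rw [hQd]; exact_mod_cast Nat.lt_succ_self _
    · intro k hk
      obtain rfl : k = s.card := by omega
      rw [coeff_add, Polynomial.coeff_C_mul, sub_mul, coeff_sub, Polynomial.coeff_C_mul]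
      have hRk : R.coeff s.card = 0 := coeff_eq_zero_of_degree_lt h1
      have hQk : Q.coeff s.card = 1 := by rw [← hQn]; exact hQm
      rw [hRk, hQk, Finset.sum_insert ha]
      rcases Nat.eq_zero_or_pos s.card with h0 | h0
      · rw [h0]; simp
        have : s = ∅ := by simpa using h0
        simp [this]
      · obtain ⟨m, hm⟩ : ∃ m, s.card = m + 1 := ⟨s.card - 1, by omega⟩
        have := h2 m hm.symm
        rw [hm, coeff_X_mul, this, hm, Nat.choose_succ_succ (m+1) 1]
        push_cast
        simp
        ring

open Polynomial in
theorem lagDown {ι : Type*} [DecidableEq ι] (x : ι → ℂ) (s : Finset ι) (hx : Set.InjOn x s) :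
    ∑ i ∈ s, x i * ∏ j ∈ s.erase i, ((x i - 1 - x j) / (x i - x j))
      = ∑ i ∈ s, x i - (s.card.choose 2 : ℂ) := by
  rcases s.eq_empty_or_nonempty with rfl | hs
  · simp
  obtain ⟨h1, h2⟩ := downPoly x s
  obtain ⟨m, hm⟩ : ∃ m, s.card = m + 1 := ⟨s.card - 1, by have := hs.card_pos; omega⟩
  have h3 := h2 m hm.symm
  have h4 := Lagrange.coeff_eq_sum hx h1
  rw [hm, Nat.add_sub_cancel, ← hm, h3] at h4
  rw [← neg_sub, h4, ← Finset.sum_neg_distrib]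
  refine Finset.sum_congr rfl fun i hi => ?_
  have e1 : ∏ j ∈ s, (x i - x j) = 0 := Finset.prod_eq_zero hi (by simp)
  have e2 : ∏ j ∈ s, (x i - (1 + x j)) = - ∏ j ∈ s.erase i, (x i - 1 - x j) := by
    rw [← Finset.mul_prod_erase _ _ hi]
    simp [sub_sub]
  rw [eval_sub, eval_mul, eval_mul, eval_prod, eval_prod]
  simp only [eval_sub, eval_X, eval_C]
  rw [e1, e2, Finset.prod_div_distrib]
  ring

open Polynomial in
theorem lagUp {ι : Type*} [DecidableEq ι] (x : ι → ℂ) (s : Finset ι) (hx : Set.InjOn x s)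
    (h0 : ∃ i ∈ s, x i = 0) (hn : ∀ i ∈ s, x i ≠ -1) :
    ∑ i ∈ s, (1 / (x i + 1)) * ∏ j ∈ s.erase i, ((x i + 1 - x j) / (x i - x j)) = 1 := by
  let y : Option ι → ℂ := fun o => o.elim (-1) x
  have hy : Set.InjOn y (Finset.insertNone s) := by
    rintro (_ | i) hi (_ | j) hj h
    · rfl
    · exact absurd h.symm (hn j (by simpa using hj))
    · exact absurd h (hn i (by simpa using hi))
    · rw [hx (by simpa using hi) (by simpa using hj) h]
  let P : ℂ[X] := ∏ j ∈ s, (Polynomial.X - Polynomial.C (x j - 1))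
  have hPd : P.degree = s.card := by
    simp only [P, degree_prod, degree_X_sub_C]; simp
  have hPm : P.Monic := monic_prod_of_monic _ _ (fun j _ => monic_X_sub_C _)
  have hPn : P.natDegree = s.card := natDegree_eq_of_degree_eq_some hPd
  have h4 := Lagrange.coeff_eq_sum (P := P) hy (by
    rw [hPd, Finset.card_insertNone]; exact_mod_cast Nat.lt_succ_self _)
  rw [Finset.card_insertNone, Nat.add_sub_cancel] at h4
  have h5 : P.coeff s.card = 1 := by rw [← hPn]; exact hPm
  rw [h5, Finset.sum_insertNone] at h4
  refine Eq.trans ?_ h4.symm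
  obtain ⟨i0, hi0, hxi0⟩ := h0
  have : P.eval (-1) = 0 := by
    rw [eval_prod]; exact Finset.prod_eq_zero hi0 (by simp [hxi0])
  simp only [y, Option.elim_none, this, zero_div, zero_add, Option.elim_some]
  refine Finset.sum_congr rfl fun i hi => ?_
  have e3 : (Finset.insertNone s).erase (some i) = Finset.insertNone (s.erase i) := by
    ext (_ | a) <;> simp
  rw [e3, Finset.prod_insertNone, eval_prod, ← Finset.mul_prod_erase _ _ hi,
    Finset.prod_div_distrib]
  have e4 : x i + 1 ≠ 0 := fun h => hn i hi (by linear_combination h)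
  simp only [eval_sub, eval_X, eval_C, Option.elim_none, Option.elim_some]
  rw [sub_neg_eq_add, one_div, inv_mul_eq_div, div_div, mul_comm (x i + 1)]
  congr 1
  rw [show x i - (x i - 1) = 1 by ring, one_mul]
  exact Finset.prod_congr rfl fun j _ => by ring

end

section
open Finset

/-- Move a bead from one position to another. -/
def mv (B : Finset ℕ) (s s' : ℕ) : Finset ℕ := insert s' (B.erase s)

theorem mem_mv {B : Finset ℕ} {s s' x : ℕ} : x ∈ mv B s s' ↔ x = s' ∨ (x ≠ s ∧ x ∈ B) := by
  simp [mv]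

theorem sum_mv {R : Type*} [AddCommGroup R] (g : ℕ → R) {B : Finset ℕ} {s s' : ℕ} (hs : s ∈ B)
    (hs' : s' ∉ B) : ∑ x ∈ mv B s s', g x = ∑ x ∈ B, g x - g s + g s' := by
  rw [mv, sum_insert (by simp [hs']), ← add_sum_erase _ _ hs]; abel

theorem prod_mv {R : Type*} [CommMonoid R] (g : ℕ → R) {B : Finset ℕ} {s s' : ℕ} (hs : s ∈ B)
    (hs' : s' ∉ B) : g s * ∏ x ∈ mv B s s', g x = g s' * ∏ x ∈ B, g x := by
  rw [mv, prod_insert (by simp [hs']), ← mul_prod_erase _ _ hs, mul_left_comm]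

/-- interaction of two beads -/
noncomputable def kk (t s y : ℕ) : ℂ :=
  if y % t = s % t then (((((s / t : ℕ) : ℤ) - ((y / t : ℕ) : ℤ)).natAbs : ℕ) : ℂ) else 1

theorem kk_symm (t s y : ℕ) : kk t s y = kk t y s := by
  unfold kk
  by_cases h : y % t = s % t
  · rw [if_pos h, if_pos h.symm, ← Int.natAbs_neg, neg_sub]
  · rw [if_neg h, if_neg (fun h' => h h'.symm)]

/-- Vandermonde part -/
noncomputable def VV (t : ℕ) (B : Finset ℕ) : ℂ := ∏ s ∈ B, ∏ y ∈ B with y < s, kk t s y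

/-- factorial part -/
noncomputable def FF (t : ℕ) (B : Finset ℕ) : ℂ := VV t B / ∏ s ∈ B, (((s / t).factorial : ℕ) : ℂ)

theorem VV_insert (t : ℕ) {C : Finset ℕ} {a : ℕ} (ha : a ∉ C) :
    VV t (insert a C) = VV t C * ∏ x ∈ C, kk t a x := by
  unfold VV
  rw [prod_insert ha]
  have h1 : (insert a C).filter (fun y => y < a) = C.filter (fun y => y < a) := by
    rw [filter_insert]; simp
  have h2 : ∀ s ∈ C, ∏ y ∈ insert a C with y < s, kk t s y =
      (if a < s then kk t a s else 1) * ∏ y ∈ C with y < s, kk t s y := by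
    intro s hs
    rw [filter_insert]
    split_ifs with h
    · rw [prod_insert (by simp [ha]), kk_symm]
    · simp
  rw [h1, prod_congr rfl h2, prod_mul_distrib, prod_filter, mul_comm, mul_assoc, mul_comm, mul_assoc]
  rw [← prod_mul_distrib]
  congr 1
  refine prod_congr rfl fun x hx => ?_
  have : x ≠ a := fun h => ha (h ▸ hx)
  rcases lt_or_gt_of_ne this with h | h
  · simp [h, h.not_gt]
  · simp [h, h.not_gt]

theorem kk_ne_zero {t s y : ℕ} (h : s ≠ y) : kk t s y ≠ 0 := by
  unfold kk
  split_ifs with h1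
  · rw [Nat.cast_ne_zero, Int.natAbs_ne_zero, sub_ne_zero]
    intro h2
    have h2 : s / t = y / t := by exact_mod_cast h2
    apply h
    rw [← Nat.div_add_mod s t, ← Nat.div_add_mod y t, h1, h2]
  · exact one_ne_zero

theorem VV_ne_zero (t : ℕ) (B : Finset ℕ) : VV t B ≠ 0 := by
  unfold VV
  refine prod_ne_zero_iff.2 fun s _ => prod_ne_zero_iff.2 fun y hy => kk_ne_zero ?_
  have := (mem_filter.1 hy).2
  omega

theorem FF_insert (t : ℕ) {C : Finset ℕ} {a : ℕ} (ha : a ∉ C) :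
    FF t (insert a C) = FF t C * ((∏ x ∈ C, kk t a x) / ((a / t).factorial : ℕ)) := by
  unfold FF
  rw [VV_insert t ha, prod_insert ha]
  rw [mul_comm (((a / t).factorial : ℕ) : ℂ), mul_div_mul_comm]

theorem natAbs_ratio (n m : ℤ) (e : ℤ) (he : e = 1 ∨ e = -1) (h : n ≠ m) (h' : n + e ≠ m) :
    (((n + e - m).natAbs : ℕ) : ℂ) = ((n - m).natAbs : ℕ) * (((n : ℂ) + e - m) / (n - m)) := by
  have hnm : (n : ℂ) - m ≠ 0 := by
    rw [sub_ne_zero]; exact_mod_cast h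
  rcases lt_or_gt_of_ne h with h1 | h1
  · have a1 : (((n + e - m).natAbs : ℕ) : ℂ) = -((n : ℂ) + e - m) := by
      have : (((n + e - m).natAbs : ℕ) : ℤ) = -(n + e - m) := by omega
      rw [← Int.cast_natCast, this]; push_cast; ring
    have a2 : (((n - m).natAbs : ℕ) : ℂ) = -((n : ℂ) - m) := by
      have : (((n - m).natAbs : ℕ) : ℤ) = -(n - m) := by omega
      rw [← Int.cast_natCast, this]; push_cast; ring
    rw [a1, a2]; field_simp
  · have a1 : (((n + e - m).natAbs : ℕ) : ℂ) = ((n : ℂ) + e - m) := by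
      have : (((n + e - m).natAbs : ℕ) : ℤ) = (n + e - m) := by omega
      rw [← Int.cast_natCast, this]; push_cast; ring
    have a2 : (((n - m).natAbs : ℕ) : ℂ) = ((n : ℂ) - m) := by
      have : (((n - m).natAbs : ℕ) : ℤ) = (n - m) := by omega
      rw [← Int.cast_natCast, this]; push_cast; ring
    rw [a1, a2]; field_simp

theorem div_inj {t x y : ℕ} (h : x % t = y % t) (h2 : x / t = y / t) : x = y := by
  rw [← Nat.div_add_mod x t, ← Nat.div_add_mod y t, h, h2]

theorem kk_down {t s x : ℕ} (ht : 0 < t) (hs : t ≤ s) (h : s ≠ x) (h' : s - t ≠ x) :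
    kk t (s - t) x = kk t s x *
      (if x % t = s % t then ((((s / t : ℕ) : ℂ) - 1 - ((x / t : ℕ) : ℂ)) /
        (((s / t : ℕ) : ℂ) - ((x / t : ℕ) : ℂ))) else 1) := by
  have e1 : (s - t) % t = s % t := (Nat.mod_eq_sub_mod hs).symm
  have e2 : (s - t) / t = s / t - 1 := by simpa using Nat.sub_mul_div s t 1
  have e3 : 1 ≤ s / t := (Nat.one_le_div_iff ht).2 hs
  unfold kk
  rw [e1]
  by_cases hc : x % t = s % t
  · simp only [hc, if_true]
    have := natAbs_ratio ((s / t : ℕ) : ℤ) ((x / t : ℕ) : ℤ) (-1) (Or.inr rfl)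
      (by intro h2; exact h (div_inj hc.symm (by exact_mod_cast h2)))
      (by intro h2; apply h'; refine div_inj (e1.trans hc.symm) ?_; omega)
    rw [e2, Nat.cast_sub e3]
    generalize s / t = n at *
    generalize x / t = m at *
    push_cast at this
    rw [← sub_eq_add_neg, ← sub_eq_add_neg] at this
    rw [← this, Nat.cast_one]
  · simp [hc]

theorem kk_up {t s x : ℕ} (ht : 0 < t) (h : s ≠ x) (h' : s + t ≠ x) :
    kk t (s + t) x = kk t s x *
      (if x % t = s % t then ((((s / t : ℕ) : ℂ) + 1 - ((x / t : ℕ) : ℂ)) /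
        (((s / t : ℕ) : ℂ) - ((x / t : ℕ) : ℂ))) else 1) := by
  have e1 : (s + t) % t = s % t := Nat.add_mod_right s t
  have e2 : (s + t) / t = s / t + 1 := Nat.add_div_right s ht
  unfold kk
  rw [e1]
  by_cases hc : x % t = s % t
  · simp only [hc, if_true]
    have := natAbs_ratio ((s / t : ℕ) : ℤ) ((x / t : ℕ) : ℤ) (1) (Or.inl rfl)
      (by intro h2; exact h (div_inj hc.symm (by exact_mod_cast h2)))
      (by intro h2; apply h'; refine div_inj (e1.trans hc.symm) ?_; omega)
    rw [e2, Nat.cast_add]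
    generalize s / t = n at *
    generalize x / t = m at *
    push_cast at this
    rw [← this, Nat.cast_one]
  · simp [hc]

theorem prod_cls (t s : ℕ) (B : Finset ℕ) (g : ℕ → ℂ) :
    ∏ x ∈ B.erase s, (if x % t = s % t then g x else 1) =
      ∏ x ∈ (B.filter (fun x => x % t = s % t)).erase s, g x := by
  rw [← prod_filter, filter_erase]

theorem FF_down {t s : ℕ} {B : Finset ℕ} (ht : 0 < t) (hs : s ∈ B) (h1 : t ≤ s) (h2 : s - t ∉ B) :
    FF t (mv B s (s - t)) = FF t B * (((s / t : ℕ) : ℂ) *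
      ∏ x ∈ (B.filter (fun x => x % t = s % t)).erase s,
        ((((s / t : ℕ) : ℂ) - 1 - ((x / t : ℕ) : ℂ)) /
        (((s / t : ℕ) : ℂ) - ((x / t : ℕ) : ℂ)))) := by
  have e2 : (s - t) / t = s / t - 1 := by simpa using Nat.sub_mul_div s t 1
  have e3 : 1 ≤ s / t := (Nat.one_le_div_iff ht).2 h1
  rw [mv, FF_insert t (by simp [h2]), e2]
  conv_rhs => rw [← insert_erase hs, FF_insert t (by simp)]
  rw [insert_erase hs, ← prod_cls]
  have : ∏ x ∈ B.erase s, kk t (s - t) x = _ := prod_congr rfl fun x hx => kk_down ht h1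
    (fun h => (mem_erase.1 hx).1 h.symm) (fun h => h2 (h ▸ (mem_erase.1 hx).2))
  rw [this, prod_mul_distrib]
  obtain ⟨n, hn⟩ : ∃ n, s / t = n + 1 := ⟨s / t - 1, by omega⟩
  rw [hn, Nat.add_sub_cancel, Nat.factorial_succ]
  have a1 : ((n : ℂ) + 1) ≠ 0 := by exact_mod_cast Nat.succ_ne_zero n
  have a2 : ((n.factorial : ℕ) : ℂ) ≠ 0 := by exact_mod_cast n.factorial_ne_zero
  push_cast
  field_simp

theorem FF_up {t s : ℕ} {B : Finset ℕ} (ht : 0 < t) (hs : s ∈ B) (h2 : s + t ∉ B) :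
    FF t (mv B s (s + t)) = FF t B * ((1 / (((s / t : ℕ) : ℂ) + 1)) *
      ∏ x ∈ (B.filter (fun x => x % t = s % t)).erase s,
        ((((s / t : ℕ) : ℂ) + 1 - ((x / t : ℕ) : ℂ)) /
        (((s / t : ℕ) : ℂ) - ((x / t : ℕ) : ℂ)))) := by
  have e2 : (s + t) / t = s / t + 1 := Nat.add_div_right s ht
  rw [mv, FF_insert t (by simp [h2]), e2]
  conv_rhs => rw [← insert_erase hs, FF_insert t (by simp)]
  rw [insert_erase hs, ← prod_cls]
  have : ∏ x ∈ B.erase s, kk t (s + t) x = _ := prod_congr rfl fun x hx => kk_up ht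
    (fun h => (mem_erase.1 hx).1 h.symm) (fun h => h2 (h ▸ (mem_erase.1 hx).2))
  rw [this, prod_mul_distrib, Nat.factorial_succ]
  generalize s / t = n
  have a1 : ((n : ℂ) + 1) ≠ 0 := by exact_mod_cast Nat.succ_ne_zero n
  have a2 : ((n.factorial : ℕ) : ℂ) ≠ 0 := by exact_mod_cast n.factorial_ne_zero
  push_cast
  field_simp

/-- number of beads on runner `c` -/
def nc (t : ℕ) (B : Finset ℕ) (c : ℕ) : ℕ := (B.filter (fun x => x % t = c)).card

/-- weight -/
def wZ (t : ℕ) (B : Finset ℕ) : ℤ :=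
  ∑ s ∈ B, ((s / t : ℕ) : ℤ) - ∑ c ∈ range t, ((nc t B c).choose 2 : ℤ)

theorem sum_down {t : ℕ} (ht : 0 < t) (B : Finset ℕ) :
    ∑ s ∈ B with t ≤ s ∧ s - t ∉ B, FF t (mv B s (s - t)) = (wZ t B : ℂ) * FF t B := by
  have h1 : ∑ s ∈ B with t ≤ s ∧ s - t ∉ B, FF t (mv B s (s - t)) =
      ∑ s ∈ B, FF t B * (((s / t : ℕ) : ℂ) *
      ∏ x ∈ (B.filter (fun x => x % t = s % t)).erase s,
        ((((s / t : ℕ) : ℂ) - 1 - ((x / t : ℕ) : ℂ)) /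
        (((s / t : ℕ) : ℂ) - ((x / t : ℕ) : ℂ)))) := by
    rw [sum_filter]
    refine sum_congr rfl fun s hs => ?_
    split_ifs with h
    · exact FF_down ht hs h.1 h.2
    · by_cases h1 : t ≤ s
      · have h2 : s - t ∈ B := by
          by_contra h2; exact h ⟨h1, h2⟩
        have e2 : (s - t) / t = s / t - 1 := by simpa using Nat.sub_mul_div s t 1
        have e3 : 1 ≤ s / t := (Nat.one_le_div_iff ht).2 h1
        rw [prod_eq_zero (i := s - t)]
        · simp
        · simp only [mem_erase, mem_filter]
          exact ⟨by omega, h2, (Nat.mod_eq_sub_mod h1).symm⟩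
        · rw [e2]; push_cast [e3]; simp
      · rw [Nat.div_eq_of_lt (by omega)]; simp
  rw [h1, ← mul_sum, mul_comm]
  congr 1
  rw [← sum_fiberwise_of_maps_to (s := B) (t := range t) (g := fun x => x % t)
    (fun x _ => mem_range.2 (Nat.mod_lt x ht))]
  have h3 : ∀ c ∈ range t, ∑ s ∈ B with s % t = c, (((s / t : ℕ) : ℂ) *
      ∏ x ∈ (B.filter (fun x => x % t = s % t)).erase s,
        ((((s / t : ℕ) : ℂ) - 1 - ((x / t : ℕ) : ℂ)) /
        (((s / t : ℕ) : ℂ) - ((x / t : ℕ) : ℂ)))) =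
      ∑ s ∈ B with s % t = c, ((s / t : ℕ) : ℂ) - ((nc t B c).choose 2 : ℂ) := by
    intro c _
    rw [nc, ← lagDown (fun s => ((s / t : ℕ) : ℂ)) (B.filter (fun x => x % t = c))]
    · refine sum_congr rfl fun s hs => ?_
      rw [(mem_filter.1 hs).2]
    · intro x hx y hy hxy
      simp only [coe_filter, Set.mem_ofPred_eq] at hx hy
      exact div_inj (hx.2.trans hy.2.symm) (Nat.cast_injective (R := ℂ) hxy)
  rw [sum_congr rfl h3, sum_sub_distrib, sum_fiberwise_of_maps_to
    (fun x _ => mem_range.2 (Nat.mod_lt x ht)), wZ]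
  push_cast
  rfl

theorem sum_up {t : ℕ} (ht : 0 < t) (B : Finset ℕ) (hB : ∀ c < t, c ∈ B) :
    ∑ s ∈ B with s + t ∉ B, FF t (mv B s (s + t)) = (t : ℂ) * FF t B := by
  have h1 : ∑ s ∈ B with s + t ∉ B, FF t (mv B s (s + t)) =
      ∑ s ∈ B, FF t B * ((1 / (((s / t : ℕ) : ℂ) + 1)) *
      ∏ x ∈ (B.filter (fun x => x % t = s % t)).erase s,
        ((((s / t : ℕ) : ℂ) + 1 - ((x / t : ℕ) : ℂ)) /
        (((s / t : ℕ) : ℂ) - ((x / t : ℕ) : ℂ)))) := by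
    rw [sum_filter]
    refine sum_congr rfl fun s hs => ?_
    by_cases h2 : s + t ∉ B
    · rw [if_pos h2]; exact FF_up ht hs h2
    · rw [if_neg h2]
      rw [not_not] at h2
      rw [prod_eq_zero (i := s + t)]
      · simp
      · simp only [mem_erase, mem_filter]
        exact ⟨by omega, h2, Nat.add_mod_right s t⟩
      · rw [Nat.add_div_right s ht]; simp
  rw [h1, ← mul_sum, mul_comm]
  congr 1
  rw [← sum_fiberwise_of_maps_to (s := B) (t := range t) (g := fun x => x % t)
    (fun x _ => mem_range.2 (Nat.mod_lt x ht))]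
  have h3 : ∀ c ∈ range t, ∑ s ∈ B with s % t = c, ((1 / (((s / t : ℕ) : ℂ) + 1)) *
      ∏ x ∈ (B.filter (fun x => x % t = s % t)).erase s,
        ((((s / t : ℕ) : ℂ) + 1 - ((x / t : ℕ) : ℂ)) /
        (((s / t : ℕ) : ℂ) - ((x / t : ℕ) : ℂ)))) = 1 := by
    intro c hc
    have hc := mem_range.1 hc
    refine Eq.trans ?_ (lagUp (fun s => ((s / t : ℕ) : ℂ)) (B.filter (fun x => x % t = c)) ?_ ?_ ?_)
    · refine sum_congr rfl fun s hs => ?_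
      rw [(mem_filter.1 hs).2]
    · intro x hx y hy hxy
      simp only [coe_filter, Set.mem_ofPred_eq] at hx hy
      exact div_inj (hx.2.trans hy.2.symm) (Nat.cast_injective (R := ℂ) hxy)
    · exact ⟨c, by simp [hB c hc, Nat.mod_eq_of_lt hc], by simp [Nat.div_eq_of_lt hc]⟩
    · intro i _ h
      have : (((i / t + 1 : ℕ)) : ℂ) = 0 := by push_cast; linear_combination h
      exact absurd this (Nat.cast_ne_zero.2 (Nat.succ_ne_zero _))
  rw [sum_congr rfl h3]
  simp

theorem nc_eq_sum (t : ℕ) (B : Finset ℕ) (c : ℕ) :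
    (nc t B c : ℤ) = ∑ x ∈ B, if x % t = c then 1 else 0 := by
  rw [nc, card_filter]; push_cast; rfl

theorem nc_mv {t : ℕ} {B : Finset ℕ} {s s' : ℕ} (hs : s ∈ B) (hs' : s' ∉ B) (h : s % t = s' % t)
    (c : ℕ) : nc t (mv B s s') c = nc t B c := by
  have : (nc t (mv B s s') c : ℤ) = nc t B c := by
    rw [nc_eq_sum, nc_eq_sum, sum_mv _ hs hs', h]; ring
  exact_mod_cast this

theorem wZ_down {t : ℕ} (ht : 0 < t) {B : Finset ℕ} {s : ℕ} (hs : s ∈ B) (h1 : t ≤ s)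
    (h2 : s - t ∉ B) : wZ t (mv B s (s - t)) = wZ t B - 1 := by
  have e1 : (s - t) % t = s % t := (Nat.mod_eq_sub_mod h1).symm
  have e2 : (s - t) / t = s / t - 1 := by simpa using Nat.sub_mul_div s t 1
  have e3 : 1 ≤ s / t := (Nat.one_le_div_iff ht).2 h1
  unfold wZ
  simp only [nc_mv hs h2 e1.symm]
  rw [sum_mv _ hs h2, e2]
  push_cast [e3]
  ring

theorem wZ_up {t : ℕ} (ht : 0 < t) {B : Finset ℕ} {s : ℕ} (hs : s ∈ B)
    (h2 : s + t ∉ B) : wZ t (mv B s (s + t)) = wZ t B + 1 := by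
  have e1 : (s + t) % t = s % t := Nat.add_mod_right s t
  have e2 : (s + t) / t = s / t + 1 := Nat.add_div_right s ht
  unfold wZ
  simp only [nc_mv hs h2 e1.symm]
  rw [sum_mv _ hs h2, e2]
  push_cast
  ring

end

section
open Finset

/-- symmetric bead configurations -/
def SCN (N : ℕ) : Finset (Finset ℕ) :=
  (range (2 * N)).powerset.filter (fun B => ∀ p < 2 * N, (p ∈ B ↔ 2 * N - 1 - p ∉ B))

theorem mem_SCN {N : ℕ} {B : Finset ℕ} :
    B ∈ SCN N ↔ (∀ p ∈ B, p < 2 * N) ∧ ∀ p < 2 * N, (p ∈ B ↔ 2 * N - 1 - p ∉ B) := by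
  simp [SCN, subset_iff]

/-- local sign of a bead -/
noncomputable def chi (N t s : ℕ) : ℂ :=
  (-1) ^ s * (if N ≤ s ∧ t ∣ 2 * s + 1 - 2 * N then -Complex.I else 1)

/-- sign of a configuration -/
noncomputable def sg (N t : ℕ) (B : Finset ℕ) : ℂ := ∏ s ∈ B, chi N t s

theorem chi_ne_zero (N t s : ℕ) : chi N t s ≠ 0 := by
  unfold chi; split_ifs <;> simp

theorem chi_shift {N t' u : ℕ} (hu : u + t' + 1 ≠ N) :
    chi N (2 * t' + 1) (u + (2 * t' + 1)) = - chi N (2 * t' + 1) u := by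
  have : (N ≤ u + (2 * t' + 1) ∧ (2 * t' + 1) ∣ 2 * (u + (2 * t' + 1)) + 1 - 2 * N) ↔
      (N ≤ u ∧ (2 * t' + 1) ∣ 2 * u + 1 - 2 * N) := by
    constructor
    · rintro ⟨h1, h2⟩
      by_cases h : N ≤ u
      · refine ⟨h, ?_⟩
        have e : 2 * (u + (2 * t' + 1)) + 1 - 2 * N = 2 * u + 1 - 2 * N + 2 * (2 * t' + 1) := by
          omega
        rw [e] at h2
        exact (Nat.dvd_add_left (Dvd.intro_left _ rfl)).1 h2
      · exfalso
        obtain ⟨k, hk⟩ := h2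
        have k2 : k < 2 := by
          by_contra hk2
          have : (2 * t' + 1) * 2 ≤ (2 * t' + 1) * k := Nat.mul_le_mul_left _ (by omega)
          omega
        interval_cases k
        · omega
        · omega
    · rintro ⟨h1, h2⟩
      refine ⟨by omega, ?_⟩
      have e : 2 * (u + (2 * t' + 1)) + 1 - 2 * N = 2 * u + 1 - 2 * N + 2 * (2 * t' + 1) := by
        omega
      rw [e]
      exact (Nat.dvd_add_left (Dvd.intro_left _ rfl)).2 h2
  unfold chi
  simp only [this]
  rw [pow_add, pow_succ (-1 : ℂ) (2 * t'), pow_mul]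
  split_ifs <;> simp

theorem chi_mid {N t' : ℕ} (hN : t' < N) :
    chi N (2 * t' + 1) (N + t') = Complex.I * chi N (2 * t' + 1) (N - 1 - t') := by
  unfold chi
  rw [if_pos ⟨by omega, by rw [show 2 * (N + t') + 1 - 2 * N = 2 * t' + 1 by omega]⟩,
    if_neg (by omega), show N + t' = (N - 1 - t') + (2 * t' + 1) by omega,
    pow_add, pow_succ (-1 : ℂ) (2 * t'), pow_mul]
  simp
  ring

/-- graded pieces -/
def SS (N t : ℕ) (M w : ℤ) : Finset (Finset ℕ) :=
  (SCN N).filter (fun B => ∑ s ∈ B, (s : ℤ) = M ∧ wZ t B = w)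

/-- graded sums -/
noncomputable def TT (N t : ℕ) (M w : ℤ) : ℂ := ∑ B ∈ SS N t M w, sg N t B * FF t B

theorem mem_SS {N t : ℕ} {M w : ℤ} {B : Finset ℕ} : B ∈ SS N t M w ↔
    B ∈ SCN N ∧ ∑ s ∈ B, (s : ℤ) = M ∧ wZ t B = w := by
  simp [SS]

theorem SCN_mv_mid {N t' : ℕ} (hN : t' < N) {B : Finset ℕ} (hB : B ∈ SCN N) (h : N + t' ∈ B) :
    mv B (N + t') (N - 1 - t') ∈ SCN N := by
  rw [mem_SCN] at hB ⊢
  obtain ⟨h1, h2⟩ := hB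
  have h3 := h2 (N + t') (by omega)
  rw [show 2 * N - 1 - (N + t') = N - 1 - t' by omega] at h3
  refine ⟨fun p hp => ?_, fun p hp => ?_⟩
  · rw [mem_mv] at hp
    rcases hp with rfl | hp
    · omega
    · exact h1 p hp.2
  · have := h2 p hp
    rw [mem_mv, mem_mv]
    by_cases hp1 : p = N + t'
    · subst hp1
      rw [show 2 * N - 1 - (N + t') = N - 1 - t' by omega]
      simp; omega
    · by_cases hp2 : p = N - 1 - t'
      · subst hp2
        rw [show 2 * N - 1 - (N - 1 - t') = N + t' by omega]
        simp; omega
      · simp only [hp1, hp2, this, false_or, ne_eq, not_false_eq_true, true_and]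
        have a : 2 * N - 1 - p ≠ N - 1 - t' := by omega
        have b : 2 * N - 1 - p ≠ N + t' := by omega
        simp [a, b]

theorem SCN_mv_mid' {N t' : ℕ} (hN : t' < N) {B : Finset ℕ} (hB : B ∈ SCN N) (h : N - 1 - t' ∈ B) :
    mv B (N - 1 - t') (N + t') ∈ SCN N := by
  rw [mem_SCN] at hB ⊢
  obtain ⟨h1, h2⟩ := hB
  have h3 := h2 (N + t') (by omega)
  rw [show 2 * N - 1 - (N + t') = N - 1 - t' by omega] at h3
  refine ⟨fun p hp => ?_, fun p hp => ?_⟩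
  · rw [mem_mv] at hp
    rcases hp with rfl | hp
    · omega
    · exact h1 p hp.2
  · have := h2 p hp
    rw [mem_mv, mem_mv]
    by_cases hp1 : p = N + t'
    · subst hp1
      rw [show 2 * N - 1 - (N + t') = N - 1 - t' by omega]
      simp; omega
    · by_cases hp2 : p = N - 1 - t'
      · subst hp2
        rw [show 2 * N - 1 - (N - 1 - t') = N + t' by omega]
        simp; omega
      · simp only [hp1, hp2, this, false_or, ne_eq, not_false_eq_true, true_and]
        have a : 2 * N - 1 - p ≠ N - 1 - t' := by omega
        have b : 2 * N - 1 - p ≠ N + t' := by omega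
        simp [a, b]

/-- symmetric double move -/
def dbl (N : ℕ) (B : Finset ℕ) (p q : ℕ) : Finset ℕ :=
  mv (mv B p q) (2 * N - 1 - q) (2 * N - 1 - p)

theorem mv_mv {B : Finset ℕ} {s s' : ℕ} (hs : s ∈ B) (hs' : s' ∉ B) : mv (mv B s s') s' s = B := by
  ext x
  simp only [mem_mv]
  have : s ≠ s' := fun h => hs' (h ▸ hs)
  by_cases h1 : x = s
  · simp [h1, hs]
  · by_cases h2 : x = s'
    · simp [h1, h2, hs']; exact this.symm
    · simp [h1, h2]

/-- data for a legal noncentral down move -/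
theorem dn_facts {N t' : ℕ} {B : Finset ℕ} (hB : B ∈ SCN N) {s : ℕ} (hs : s ∈ B)
    (h1 : 2 * t' + 1 ≤ s) (h2 : s - (2 * t' + 1) ∉ B) :
    s < 2 * N ∧ 2 * N - 1 - s ∉ B ∧ 2 * N - 1 - s + (2 * t' + 1) ∈ B := by
  rw [mem_SCN] at hB
  obtain ⟨a1, a2⟩ := hB
  have b1 := a1 s hs
  refine ⟨b1, (a2 s b1).1 hs, ?_⟩
  have b2 := a2 (s - (2 * t' + 1)) (by omega)
  rw [show 2 * N - 1 - (s - (2 * t' + 1)) = 2 * N - 1 - s + (2 * t' + 1) by omega] at b2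
  tauto

theorem up_facts {N t' : ℕ} {B : Finset ℕ} (hB : B ∈ SCN N) (hlow : ∀ c < 2 * t' + 1, c ∈ B)
    {u : ℕ} (hu : u ∈ B) (h2 : u + (2 * t' + 1) ∉ B) :
    u + (2 * t' + 1) < 2 * N ∧ 2 * N - 1 - u ∉ B ∧ 2 * N - 1 - u - (2 * t' + 1) ∈ B := by
  rw [mem_SCN] at hB
  obtain ⟨a1, a2⟩ := hB
  have b1 := a1 u hu
  have b3 : u + (2 * t' + 1) < 2 * N := by
    by_contra h
    exact (a2 u b1).1 hu (hlow _ (by omega))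
  refine ⟨b3, (a2 u b1).1 hu, ?_⟩
  have b2 := a2 (u + (2 * t' + 1)) b3
  rw [show 2 * N - 1 - (u + (2 * t' + 1)) = 2 * N - 1 - u - (2 * t' + 1) by omega] at b2
  tauto

theorem SCN_double {N : ℕ} {B : Finset ℕ} (hB : B ∈ SCN N) {p q : ℕ} (hp : p ∈ B) (hq : q ∉ B)
    (hq2 : q < 2 * N) (hpq : p + q ≠ 2 * N - 1) :
    dbl N B p q ∈ SCN N := by
  unfold dbl
  rw [mem_SCN] at hB ⊢
  obtain ⟨h1, h2⟩ := hB
  have hp2 := h1 p hp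
  have c1 := h2 p hp2
  have c2 := h2 q hq2
  have hne : p ≠ q := fun h => hq (h ▸ hp)
  refine ⟨fun x hx => ?_, fun x hx => ?_⟩
  · simp only [mem_mv] at hx
    rcases hx with rfl | ⟨_, rfl | ⟨_, hx⟩⟩
    · omega
    · exact hq2
    · exact h1 x hx
  · have := h2 x hx
    simp only [mem_mv]
    have e1 : 2 * N - 1 - x = 2 * N - 1 - p ↔ x = p := by omega
    have e2 : 2 * N - 1 - x = 2 * N - 1 - q ↔ x = q := by omega
    have e3 : 2 * N - 1 - x = p ↔ x = 2 * N - 1 - p := by omega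
    have e4 : 2 * N - 1 - x = q ↔ x = 2 * N - 1 - q := by omega
    simp only [ne_eq, e1, e2, e3, e4]
    have n1 : p ≠ 2 * N - 1 - p := by omega
    have n2 : p ≠ 2 * N - 1 - q := by omega
    have n3 : q ≠ 2 * N - 1 - p := by omega
    have n4 : q ≠ 2 * N - 1 - q := by omega
    have n5 : 2 * N - 1 - p ≠ 2 * N - 1 - q := by omega
    grind

theorem dbl_mem {N : ℕ} {B : Finset ℕ} (hB : B ∈ SCN N) {p q : ℕ} (hp : p ∈ B) (hq : q ∉ B)
    (hq2 : q < 2 * N) (hpq : p + q ≠ 2 * N - 1) :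
    2 * N - 1 - q ∈ mv B p q ∧ 2 * N - 1 - p ∉ mv B p q := by
  rw [mem_SCN] at hB
  obtain ⟨h1, h2⟩ := hB
  have hp2 := h1 p hp
  have c1 := h2 p hp2
  have c2 := h2 q hq2
  simp only [mem_mv]
  have n2 : 2 * N - 1 - q ≠ p := by omega
  have n3 : 2 * N - 1 - p ≠ q := by omega
  grind

theorem dbl_half {N : ℕ} {B : Finset ℕ} (hB : B ∈ SCN N) {p q : ℕ} (hp : p ∈ B) (hq : q ∉ B)
    (hq2 : q < 2 * N) (hpq : p + q ≠ 2 * N - 1) :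
    mv (dbl N B p q) (2 * N - 1 - p) (2 * N - 1 - q) = mv B p q := by
  obtain ⟨h1, h2⟩ := dbl_mem hB hp hq hq2 hpq
  exact mv_mv h1 h2

theorem dbl_dbl {N : ℕ} {B : Finset ℕ} (hB : B ∈ SCN N) {p q : ℕ} (hp : p ∈ B) (hq : q ∉ B)
    (hq2 : q < 2 * N) (hpq : p + q ≠ 2 * N - 1) :
    dbl N (dbl N B p q) (2 * N - 1 - p) (2 * N - 1 - q) = B := by
  have hp2 := (mem_SCN.1 hB).1 p hp
  rw [dbl, dbl_half hB hp hq hq2 hpq, show 2 * N - 1 - (2 * N - 1 - q) = q by omega,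
    show 2 * N - 1 - (2 * N - 1 - p) = p by omega, mv_mv hp hq]

theorem sum_dbl {R : Type*} [AddCommGroup R] (g : ℕ → R) {N : ℕ} {B : Finset ℕ} (hB : B ∈ SCN N)
    {p q : ℕ} (hp : p ∈ B) (hq : q ∉ B) (hq2 : q < 2 * N) (hpq : p + q ≠ 2 * N - 1) :
    ∑ x ∈ dbl N B p q, g x =
      ∑ x ∈ B, g x - g p + g q - g (2 * N - 1 - q) + g (2 * N - 1 - p) := by
  obtain ⟨h1, h2⟩ := dbl_mem hB hp hq hq2 hpq
  rw [dbl, sum_mv _ h1 h2, sum_mv _ hp hq]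

theorem sg_mv {N t : ℕ} {B : Finset ℕ} {s s' : ℕ} (hs : s ∈ B) (hs' : s' ∉ B) :
    chi N t s * sg N t (mv B s s') = chi N t s' * sg N t B := prod_mv _ hs hs'

theorem sg_dbl {N t' : ℕ} {B : Finset ℕ} (hB : B ∈ SCN N) {u : ℕ}
    (hN : u + t' + 1 ≠ N) (hq2 : u + (2 * t' + 1) < 2 * N) :
    (u ∈ B → u + (2 * t' + 1) ∉ B →
      sg N (2 * t' + 1) (dbl N B u (u + (2 * t' + 1))) = sg N (2 * t' + 1) B) ∧
    (u ∉ B → u + (2 * t' + 1) ∈ B →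
      sg N (2 * t' + 1) (dbl N B (u + (2 * t' + 1)) u) = sg N (2 * t' + 1) B) := by
  have e1 := chi_shift (N := N) (t' := t') (u := u) hN
  have e2 := chi_shift (N := N) (t' := t') (u := 2 * N - 1 - (u + (2 * t' + 1))) (by omega)
  rw [show 2 * N - 1 - (u + (2 * t' + 1)) + (2 * t' + 1) = 2 * N - 1 - u by omega] at e2
  have c1 := chi_ne_zero N (2 * t' + 1) u
  have c2 := chi_ne_zero N (2 * t' + 1) (2 * N - 1 - (u + (2 * t' + 1)))
  constructor
  · intro hp hq
    obtain ⟨h1, h2⟩ := dbl_mem hB hp hq hq2 (by omega)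
    have a1 := sg_mv (N := N) (t := 2 * t' + 1) h1 h2
    have a2 := sg_mv (N := N) (t := 2 * t' + 1) hp hq
    rw [e1] at a2
    rw [e2] at a1
    change _ * sg N (2 * t' + 1) (dbl N B _ _) = _ at a1
    have a3 := mul_left_cancel₀ c2 (a1.trans (neg_mul_comm _ _))
    have a4 := mul_left_cancel₀ c1 (a2.trans (neg_mul_comm _ _))
    rw [a3, a4, neg_neg]
  · intro hq hp
    obtain ⟨h1, h2⟩ := dbl_mem hB hp hq (by omega) (by omega)
    have a1 := sg_mv (N := N) (t := 2 * t' + 1) h1 h2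
    have a2 := sg_mv (N := N) (t := 2 * t' + 1) hp hq
    rw [e1, neg_mul_comm] at a2
    rw [e2, neg_mul_comm] at a1
    change _ * -sg N (2 * t' + 1) (dbl N B _ _) = _ at a1
    have a3 := mul_left_cancel₀ c2 a1
    have a4 := mul_left_cancel₀ c1 a2
    rw [← neg_eq_iff_eq_neg.2 a3.symm, ← a4]

theorem wZ_dbl_down {N t' : ℕ} {B : Finset ℕ} (hB : B ∈ SCN N) {s : ℕ} (hs : s ∈ B)
    (h1 : 2 * t' + 1 ≤ s) (h2 : s - (2 * t' + 1) ∉ B) (hc : s ≠ N + t') :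
    wZ (2 * t' + 1) (dbl N B s (s - (2 * t' + 1))) = wZ (2 * t' + 1) B - 2 := by
  have hs2 := (mem_SCN.1 hB).1 s hs
  obtain ⟨h3, h4⟩ := dbl_mem hB hs h2 (by omega) (by omega)
  rw [dbl]
  rw [show 2 * N - 1 - s = 2 * N - 1 - (s - (2 * t' + 1)) - (2 * t' + 1) by omega] at h4 ⊢
  rw [wZ_down (by omega) h3 (by omega) h4, wZ_down (by omega) hs h1 h2]
  ring

theorem wZ_dbl_up {N t' : ℕ} {B : Finset ℕ} (hB : B ∈ SCN N) {u : ℕ} (hu : u ∈ B)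
    (h1 : u + (2 * t' + 1) < 2 * N) (h2 : u + (2 * t' + 1) ∉ B) (hc : u + t' + 1 ≠ N) :
    wZ (2 * t' + 1) (dbl N B u (u + (2 * t' + 1))) = wZ (2 * t' + 1) B + 2 := by
  obtain ⟨h3, h4⟩ := dbl_mem hB hu h2 (by omega) (by omega)
  rw [dbl]
  rw [show 2 * N - 1 - u = 2 * N - 1 - (u + (2 * t' + 1)) + (2 * t' + 1) by omega] at h4 ⊢
  rw [wZ_up (by omega) h3 h4, wZ_up (by omega) hu h2]
  ring

/-- legal down moves -/
def XX (N t : ℕ) (M w : ℤ) : Finset (Σ _ : Finset ℕ, ℕ) :=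
  (SS N t M w).sigma (fun B => B.filter (fun s => t ≤ s ∧ s - t ∉ B))

/-- legal up moves -/
def YY (N t : ℕ) (M w : ℤ) : Finset (Σ _ : Finset ℕ, ℕ) :=
  (SS N t M w).sigma (fun B => B.filter (fun s => s + t ∉ B))

theorem sum_XX (N t' : ℕ) (M w : ℤ) :
    ∑ a ∈ XX N (2 * t' + 1) M w,
      sg N (2 * t' + 1) a.1 * FF (2 * t' + 1) (mv a.1 a.2 (a.2 - (2 * t' + 1)))
      = w * TT N (2 * t' + 1) M w := by
  rw [XX, sum_sigma, TT, mul_sum]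
  refine sum_congr rfl fun B hB => ?_
  dsimp only
  rw [← mul_sum, sum_down (by omega), (mem_SS.1 hB).2.2]
  ring

theorem sum_YY (N t' : ℕ) (M w : ℤ)
    (hlow : ∀ B ∈ SS N (2 * t' + 1) M w, ∀ c < 2 * t' + 1, c ∈ B) :
    ∑ a ∈ YY N (2 * t' + 1) M w,
      sg N (2 * t' + 1) a.1 * FF (2 * t' + 1) (mv a.1 a.2 (a.2 + (2 * t' + 1)))
      = ((2 * t' + 1 : ℕ) : ℂ) * TT N (2 * t' + 1) M w := by
  rw [YY, sum_sigma, TT, mul_sum]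
  refine sum_congr rfl fun B hB => ?_
  dsimp only
  rw [← mul_sum, sum_up (by omega) _ (hlow B hB)]
  ring

theorem mem_XX {N t : ℕ} {M w : ℤ} {a : Σ _ : Finset ℕ, ℕ} : a ∈ XX N t M w ↔
    (a.1 ∈ SCN N ∧ ∑ s ∈ a.1, (s : ℤ) = M ∧ wZ t a.1 = w) ∧ a.2 ∈ a.1 ∧ t ≤ a.2 ∧
      a.2 - t ∉ a.1 := by
  simp [XX, mem_SS]

theorem mem_YY {N t : ℕ} {M w : ℤ} {a : Σ _ : Finset ℕ, ℕ} : a ∈ YY N t M w ↔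
    (a.1 ∈ SCN N ∧ ∑ s ∈ a.1, (s : ℤ) = M ∧ wZ t a.1 = w) ∧ a.2 ∈ a.1 ∧ 
      a.2 + t ∉ a.1 := by
  simp [YY, mem_SS]

theorem sum_X2 (N t' : ℕ) (M w : ℤ)
    (hlow : ∀ B ∈ SS N (2 * t' + 1) (M - 2 * (2 * t' + 1)) (w - 2), ∀ c < 2 * t' + 1, c ∈ B) :
    ∑ a ∈ XX N (2 * t' + 1) M w with a.2 ≠ N + t',
      sg N (2 * t' + 1) a.1 * FF (2 * t' + 1) (mv a.1 a.2 (a.2 - (2 * t' + 1)))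
    = ∑ a ∈ YY N (2 * t' + 1) (M - 2 * (2 * t' + 1)) (w - 2) with a.2 + t' + 1 ≠ N,
      sg N (2 * t' + 1) a.1 * FF (2 * t' + 1) (mv a.1 a.2 (a.2 + (2 * t' + 1))) := by
  refine sum_bij'
    (fun a _ => ⟨dbl N a.1 a.2 (a.2 - (2 * t' + 1)), 2 * N - 1 - a.2⟩)
    (fun a _ => ⟨dbl N a.1 a.2 (a.2 + (2 * t' + 1)), 2 * N - 1 - a.2⟩) ?_ ?_ ?_ ?_ ?_
  · rintro ⟨B, s⟩ ha
    rw [mem_filter, mem_XX] at ha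
    obtain ⟨⟨⟨hB, hM, hw⟩, hs, h1, h2⟩, hc⟩ := ha
    dsimp only at *
    have hs2 := (mem_SCN.1 hB).1 s hs
    obtain ⟨h3, h4⟩ := dbl_mem hB hs h2 (by omega) (by omega)
    rw [mem_filter, mem_YY]
    dsimp only
    refine ⟨⟨⟨SCN_double hB hs h2 (by omega) (by omega), ?_, ?_⟩, ?_, ?_⟩, by omega⟩
    · rw [sum_dbl _ hB hs h2 (by omega) (by omega), hM]
      omega
    · rw [wZ_dbl_down hB hs h1 h2 hc, hw]
    · rw [dbl, mem_mv]; left; rfl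
    · rw [dbl, mem_mv, show 2 * N - 1 - s + (2 * t' + 1) = 2 * N - 1 - (s - (2 * t' + 1)) by omega]
      simp; omega
  · rintro ⟨B, u⟩ ha
    rw [mem_filter, mem_YY] at ha
    obtain ⟨⟨⟨hB, hM, hw⟩, hs, h2⟩, hc⟩ := ha
    dsimp only at *
    have hl := hlow B (mem_SS.2 ⟨hB, hM, hw⟩)
    obtain ⟨h1, -, -⟩ := up_facts hB hl hs h2
    obtain ⟨h3, h4⟩ := dbl_mem hB hs h2 (by omega) (by omega)
    rw [mem_filter, mem_XX]
    dsimp only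
    refine ⟨⟨⟨SCN_double hB hs h2 (by omega) (by omega), ?_, ?_⟩, ?_, by omega, ?_⟩, by omega⟩
    · rw [sum_dbl _ hB hs h2 (by omega) (by omega), hM]
      omega
    · rw [wZ_dbl_up hB hs h1 h2 hc, hw]; ring
    · rw [dbl, mem_mv]; left; rfl
    · rw [dbl, mem_mv, show 2 * N - 1 - u - (2 * t' + 1) = 2 * N - 1 - (u + (2 * t' + 1)) by omega]
      simp; omega
  · rintro ⟨B, s⟩ ha
    rw [mem_filter, mem_XX] at ha
    obtain ⟨⟨⟨hB, hM, hw⟩, hs, h1, h2⟩, hc⟩ := ha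
    dsimp only at *
    have hs2 := (mem_SCN.1 hB).1 s hs
    rw [show 2 * N - 1 - s + (2 * t' + 1) = 2 * N - 1 - (s - (2 * t' + 1)) by omega,
      dbl_dbl hB hs h2 (by omega) (by omega), show 2 * N - 1 - (2 * N - 1 - s) = s by omega]
  · rintro ⟨B, u⟩ ha
    rw [mem_filter, mem_YY] at ha
    obtain ⟨⟨⟨hB, hM, hw⟩, hs, h2⟩, hc⟩ := ha
    dsimp only at *
    have hl := hlow B (mem_SS.2 ⟨hB, hM, hw⟩)
    obtain ⟨h1, -, -⟩ := up_facts hB hl hs h2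
    rw [show 2 * N - 1 - u - (2 * t' + 1) = 2 * N - 1 - (u + (2 * t' + 1)) by omega,
      dbl_dbl hB hs h2 (by omega) (by omega), show 2 * N - 1 - (2 * N - 1 - u) = u by omega]
  · rintro ⟨B, s⟩ ha
    rw [mem_filter, mem_XX] at ha
    obtain ⟨⟨⟨hB, hM, hw⟩, hs, h1, h2⟩, hc⟩ := ha
    dsimp only at *
    have hs2 := (mem_SCN.1 hB).1 s hs
    rw [show 2 * N - 1 - s + (2 * t' + 1) = 2 * N - 1 - (s - (2 * t' + 1)) by omega,
      dbl_half hB hs h2 (by omega) (by omega)]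
    have := (sg_dbl hB (u := s - (2 * t' + 1)) (t' := t') (by omega) (by omega)).2 h2
    rw [show s - (2 * t' + 1) + (2 * t' + 1) = s by omega] at this
    rw [this hs]

theorem sum_X1 (N t' : ℕ) (hN : t' < N) (M w : ℤ) :
    ∑ a ∈ XX N (2 * t' + 1) M w with ¬ a.2 ≠ N + t',
      sg N (2 * t' + 1) a.1 * FF (2 * t' + 1) (mv a.1 a.2 (a.2 - (2 * t' + 1)))
    = ∑ B ∈ SS N (2 * t' + 1) (M - (2 * t' + 1)) (w - 1) with N - 1 - t' ∈ B,
      Complex.I * (sg N (2 * t' + 1) B * FF (2 * t' + 1) B) := by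
  refine sum_bij' (fun a _ => mv a.1 (N + t') (N - 1 - t'))
    (fun B _ => ⟨mv B (N - 1 - t') (N + t'), N + t'⟩) ?_ ?_ ?_ ?_ ?_
  · rintro ⟨B, s⟩ ha
    rw [mem_filter, mem_XX, not_not] at ha
    obtain ⟨⟨⟨hB, hM, hw⟩, hs, h1, h2⟩, rfl⟩ := ha
    dsimp only at *
    rw [show N + t' - (2 * t' + 1) = N - 1 - t' by omega] at h2
    rw [mem_filter, mem_SS]
    refine ⟨⟨SCN_mv_mid hN hB hs, ?_, ?_⟩, by simp [mem_mv]⟩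
    · rw [sum_mv _ hs h2, hM]; omega
    · have := wZ_down (t := 2 * t' + 1) (by omega) hs h1
      rw [show N + t' - (2 * t' + 1) = N - 1 - t' by omega] at this
      rw [this h2, hw]
  · intro B hB
    rw [mem_filter, mem_SS] at hB
    obtain ⟨⟨hB, hM, hw⟩, hs⟩ := hB
    have h2 : N + t' ∉ B := by
      have := ((mem_SCN.1 hB).2 (N - 1 - t') (by omega)).1 hs
      rwa [show 2 * N - 1 - (N - 1 - t') = N + t' by omega] at this
    rw [mem_filter, mem_XX, not_not]
    refine ⟨⟨⟨SCN_mv_mid' hN hB hs, ?_, ?_⟩, by simp [mem_mv], by dsimp only; omega, ?_⟩, rfl⟩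
    · rw [sum_mv _ hs h2, hM]; omega
    · have := wZ_up (t := 2 * t' + 1) (by omega) hs
      rw [show N - 1 - t' + (2 * t' + 1) = N + t' by omega] at this
      rw [this h2, hw]; ring
    · dsimp only
      rw [show N + t' - (2 * t' + 1) = N - 1 - t' by omega, mem_mv]
      simp; omega
  · rintro ⟨B, s⟩ ha
    rw [mem_filter, mem_XX, not_not] at ha
    obtain ⟨⟨⟨hB, hM, hw⟩, hs, h1, h2⟩, rfl⟩ := ha
    dsimp only at *
    rw [show N + t' - (2 * t' + 1) = N - 1 - t' by omega] at h2
    rw [mv_mv hs h2]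
  · intro B hB
    rw [mem_filter, mem_SS] at hB
    obtain ⟨⟨hB, hM, hw⟩, hs⟩ := hB
    have h2 : N + t' ∉ B := by
      have := ((mem_SCN.1 hB).2 (N - 1 - t') (by omega)).1 hs
      rwa [show 2 * N - 1 - (N - 1 - t') = N + t' by omega] at this
    exact mv_mv hs h2
  · rintro ⟨B, s⟩ ha
    rw [mem_filter, mem_XX, not_not] at ha
    obtain ⟨⟨⟨hB, hM, hw⟩, hs, h1, h2⟩, rfl⟩ := ha
    dsimp only at *
    rw [show N + t' - (2 * t' + 1) = N - 1 - t' by omega] at h2 ⊢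
    have := sg_mv (N := N) (t := 2 * t' + 1) hs h2
    rw [chi_mid hN, mul_comm Complex.I, mul_assoc] at this
    have := mul_left_cancel₀ (chi_ne_zero _ _ _) this
    rw [← this, mul_assoc]

theorem sum_Y1 (N t' : ℕ) (hN : t' < N) (M w : ℤ) :
    ∑ a ∈ YY N (2 * t' + 1) (M - 2 * (2 * t' + 1)) (w - 2) with ¬ a.2 + t' + 1 ≠ N,
      sg N (2 * t' + 1) a.1 * FF (2 * t' + 1) (mv a.1 a.2 (a.2 + (2 * t' + 1)))
    = ∑ B ∈ SS N (2 * t' + 1) (M - (2 * t' + 1)) (w - 1) with ¬ N - 1 - t' ∈ B,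
      -Complex.I * (sg N (2 * t' + 1) B * FF (2 * t' + 1) B) := by
  refine sum_bij' (fun a _ => mv a.1 (N - 1 - t') (N + t'))
    (fun B _ => ⟨mv B (N + t') (N - 1 - t'), N - 1 - t'⟩) ?_ ?_ ?_ ?_ ?_
  · rintro ⟨B, s⟩ ha
    rw [mem_filter, mem_YY, not_not] at ha
    obtain ⟨⟨⟨hB, hM, hw⟩, hs, h2⟩, hc⟩ := ha
    dsimp only at *
    obtain rfl : s = N - 1 - t' := by omega
    have h2' := h2
    rw [show N - 1 - t' + (2 * t' + 1) = N + t' by omega] at h2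
    rw [mem_filter, mem_SS]
    refine ⟨⟨SCN_mv_mid' hN hB hs, ?_, ?_⟩, by simp [mem_mv]; omega⟩
    · rw [sum_mv _ hs h2, hM]; omega
    · have := wZ_up (t := 2 * t' + 1) (by omega) hs h2'
      rw [show N - 1 - t' + (2 * t' + 1) = N + t' by omega] at this
      rw [this, hw]; ring
  · intro B hB
    rw [mem_filter, mem_SS] at hB
    obtain ⟨⟨hB, hM, hw⟩, h2⟩ := hB
    have hs : N + t' ∈ B := by
      rw [(mem_SCN.1 hB).2 (N + t') (by omega)]
      rwa [show 2 * N - 1 - (N + t') = N - 1 - t' by omega]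
    rw [mem_filter, mem_YY, not_not]
    refine ⟨⟨⟨SCN_mv_mid hN hB hs, ?_, ?_⟩, by simp [mem_mv], ?_⟩, by dsimp only; omega⟩
    · rw [sum_mv _ hs h2, hM]; omega
    · have := wZ_down (t := 2 * t' + 1) (by omega) hs (by omega)
      rw [show N + t' - (2 * t' + 1) = N - 1 - t' by omega] at this
      rw [this h2, hw]; ring
    · dsimp only
      rw [show N - 1 - t' + (2 * t' + 1) = N + t' by omega, mem_mv]
      simp; omega
  · rintro ⟨B, s⟩ ha
    rw [mem_filter, mem_YY, not_not] at ha
    obtain ⟨⟨⟨hB, hM, hw⟩, hs, h2⟩, hc⟩ := ha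
    dsimp only at *
    obtain rfl : s = N - 1 - t' := by omega
    rw [show N - 1 - t' + (2 * t' + 1) = N + t' by omega] at h2
    rw [mv_mv hs h2]
  · intro B hB
    rw [mem_filter, mem_SS] at hB
    obtain ⟨⟨hB, hM, hw⟩, h2⟩ := hB
    have hs : N + t' ∈ B := by
      rw [(mem_SCN.1 hB).2 (N + t') (by omega)]
      rwa [show 2 * N - 1 - (N + t') = N - 1 - t' by omega]
    exact mv_mv hs h2
  · rintro ⟨B, s⟩ ha
    rw [mem_filter, mem_YY, not_not] at ha
    obtain ⟨⟨⟨hB, hM, hw⟩, hs, h2⟩, hc⟩ := ha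
    dsimp only at *
    obtain rfl : s = N - 1 - t' := by omega
    rw [show N - 1 - t' + (2 * t' + 1) = N + t' by omega] at h2 ⊢
    have := sg_mv (N := N) (t := 2 * t' + 1) hs h2
    rw [chi_mid hN, mul_comm Complex.I, mul_assoc] at this
    have := mul_left_cancel₀ (chi_ne_zero _ _ _) this
    rw [this]
    linear_combination ((sg N (2 * t' + 1) B) *
      FF (2 * t' + 1) (mv B (N - 1 - t') (N + t'))) * Complex.I_mul_I

theorem TT_rec (N t' : ℕ) (hN : t' < N) (M w : ℤ)
    (hlow : ∀ B ∈ SS N (2 * t' + 1) (M - 2 * (2 * t' + 1)) (w - 2), ∀ c < 2 * t' + 1, c ∈ B) :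
    w * TT N (2 * t' + 1) M w = Complex.I * TT N (2 * t' + 1) (M - (2 * t' + 1)) (w - 1) +
      ((2 * t' + 1 : ℕ) : ℂ) * TT N (2 * t' + 1) (M - 2 * (2 * t' + 1)) (w - 2) := by
  rw [← sum_XX, ← sum_YY _ _ _ _ hlow,
    ← sum_filter_add_sum_filter_not (XX N (2 * t' + 1) M w) (fun a => a.2 ≠ N + t'),
    ← sum_filter_add_sum_filter_not (YY N (2 * t' + 1) (M - 2 * (2 * t' + 1)) (w - 2))
      (fun a => a.2 + t' + 1 ≠ N), sum_X2 _ _ _ _ hlow, sum_X1 _ _ hN, sum_Y1 _ _ hN, TT,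
    ← sum_filter_add_sum_filter_not (SS N (2 * t' + 1) (M - (2 * t' + 1)) (w - 1))
      (fun B => N - 1 - t' ∈ B), ← mul_sum, ← mul_sum]
  ring

end

section
open Finset

theorem sum_SCN {R : Type*} [AddCommMonoid R] (g : ℕ → R) {N : ℕ} {B : Finset ℕ} (hB : B ∈ SCN N) :
    ∑ s ∈ B, g s = ∑ a ∈ range N, if N + a ∈ B then g (N + a) else g (N - 1 - a) := by
  rw [mem_SCN] at hB
  obtain ⟨h1, h2⟩ := hB
  have e : ∑ s ∈ B, g s = ∑ s ∈ range (N + N), if s ∈ B then g s else 0 := by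
    rw [← sum_filter]
    refine sum_congr ?_ fun _ _ => rfl
    ext x
    simp only [mem_filter, mem_range]
    constructor
    · intro h; exact ⟨by have := h1 x h; omega, h⟩
    · exact fun h => h.2
  rw [e, sum_range_add, ← sum_range_reflect, ← sum_add_distrib]
  refine sum_congr rfl fun a ha => ?_
  rw [mem_range] at ha
  have h3 := h2 (N + a) (by omega)
  rw [show 2 * N - 1 - (N + a) = N - 1 - a by omega] at h3
  by_cases h : N + a ∈ B
  · have := h3.1 h
    simp [h, this]
  · have : N - 1 - a ∈ B := by by_contra h5; exact h (h3.2 h5)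
    simp [h, this]

/-- energy of the vacuum -/
def b0 (N : ℕ) : ℤ := ∑ a ∈ range N, (a : ℤ)

theorem sum_energy {N : ℕ} {B : Finset ℕ} (hB : B ∈ SCN N) :
    ∑ s ∈ B, (s : ℤ) = b0 N + ∑ a ∈ range N, if N + a ∈ B then (2 * (a : ℤ) + 1) else 0 := by
  rw [sum_SCN _ hB, b0, ← sum_range_reflect (fun a : ℕ => (a : ℤ)), ← sum_add_distrib]
  refine sum_congr rfl fun a ha => ?_
  rw [mem_range] at ha
  split_ifs with h
  · push_cast [show 1 ≤ N by omega, show a ≤ N - 1 by omega, Nat.cast_sub]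
    ring
  · simp

theorem low_of_energy {N t : ℕ} {B : Finset ℕ} (htN : t ≤ N) (hB : B ∈ SCN N)
    (h : ∑ s ∈ B, (s : ℤ) ≤ b0 N + 2 * N - 2 * t) : ∀ c < t, c ∈ B := by
  intro c hc
  by_contra hcB
  rw [sum_energy hB] at h
  have h2 := (mem_SCN.1 hB).2 c (by omega)
  have h3 : N + (N - 1 - c) ∈ B := by
    by_contra h4
    rw [show N + (N - 1 - c) = 2 * N - 1 - c by omega] at h4
    exact hcB (h2.2 h4)
  have h4 := single_le_sum (f := fun a => if N + a ∈ B then (2 * (a : ℤ) + 1) else 0)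
    (s := range N) (fun a _ => by split_ifs <;> positivity) (mem_range.2 (show N - 1 - c < N by omega))
  simp only [h3, if_true] at h4
  omega

theorem card_pairs (C : Finset ℕ) : ∑ s ∈ C, (C.filter (fun y => y < s)).card = C.card.choose 2 := by
  induction C using Finset.induction_on_max with
  | empty => simp
  | insert a s h ih =>
    have ha : a ∉ s := fun h' => lt_irrefl _ (h a h')
    rw [sum_insert ha, card_insert_of_notMem ha, Nat.choose_succ_succ' _ 1, ← ih, Nat.choose_one_right]
    congr 1
    · congr 1
      ext x
      simp only [mem_filter, mem_insert]
      constructor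
      · rintro ⟨rfl | h1, h2⟩
        · omega
        · exact h1
      · exact fun h1 => ⟨Or.inr h1, h x h1⟩
    · refine sum_congr rfl fun x hx => ?_
      congr 1
      ext y
      simp only [mem_filter, mem_insert]
      have := h x hx
      constructor
      · rintro ⟨rfl | h1, h2⟩
        · omega
        · exact ⟨h1, h2⟩
      · exact fun h1 => ⟨Or.inr h1.1, h1.2⟩

theorem below_image {t : ℕ} (ht : 0 < t) (s : ℕ) :
    (range s).filter (fun y => y % t = s % t) = (range (s / t)).image (fun q => s % t + t * q) := by
  ext y
  simp only [mem_filter, mem_range, mem_image]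
  constructor
  · rintro ⟨h1, h2⟩
    refine ⟨y / t, ?_, by rw [← h2]; exact Nat.mod_add_div y t⟩
    by_contra h3
    have := Nat.mul_le_mul_left t (not_lt.1 h3)
    have := Nat.mod_add_div y t
    have := Nat.mod_add_div s t
    omega
  · rintro ⟨q, hq, rfl⟩
    refine ⟨?_, by simp⟩
    have := Nat.mul_lt_mul_of_pos_left hq ht
    have := Nat.mod_add_div s t
    omega

theorem below_inj {t : ℕ} (ht : 0 < t) (s : ℕ) : Set.InjOn (fun q => s % t + t * q) (range (s / t)) := by
  intro a _ b _ h
  simp only [add_right_inj] at h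
  exact Nat.eq_of_mul_eq_mul_left ht h

theorem card_below {t : ℕ} (ht : 0 < t) (s : ℕ) :
    ((range s).filter (fun y => y % t = s % t)).card = s / t := by
  rw [below_image ht, card_image_of_injOn (below_inj ht s), card_range]

theorem runner_filter (B : Finset ℕ) (t s : ℕ) :
    ((range s).filter (fun y => y % t = s % t)).filter (· ∈ B) =
      (B.filter (fun y => y % t = s % t)).filter (fun y => y < s) := by
  ext; simp; tauto

theorem sum_nc {t : ℕ} (ht : 0 < t) (B : Finset ℕ) :
    ∑ s ∈ B, ((B.filter (fun y => y % t = s % t)).filter (fun y => y < s)).card =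
      ∑ c ∈ range t, (nc t B c).choose 2 := by
  rw [← sum_fiberwise_of_maps_to (s := B) (t := range t) (g := fun s => s % t)
    (fun s _ => mem_range.2 (Nat.mod_lt s ht))]
  refine sum_congr rfl fun c _ => ?_
  rw [nc, ← card_pairs]
  refine sum_congr rfl fun s hs => ?_
  rw [(mem_filter.1 hs).2]

/-- pairs (bead, hole below in same runner) -/
def hol (t : ℕ) (B : Finset ℕ) (s : ℕ) : Finset ℕ :=
  ((range s).filter (fun y => y % t = s % t)).filter (· ∉ B)

theorem wZ_eq {t : ℕ} (ht : 0 < t) (B : Finset ℕ) :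
    wZ t B = ∑ s ∈ B, ((hol t B s).card : ℤ) := by
  have h := sum_nc ht B
  have h2 : ∑ s ∈ B, s / t = ∑ s ∈ B, ((B.filter (fun y => y % t = s % t)).filter (fun y => y < s)).card
      + ∑ s ∈ B, (hol t B s).card := by
    rw [← sum_add_distrib]
    refine sum_congr rfl fun s _ => ?_
    rw [← runner_filter, hol, card_filter_add_card_filter_not, card_below ht]
  rw [h] at h2
  unfold wZ
  zify at h2
  push_cast
  linarith

theorem FF_eq {t : ℕ} (ht : 0 < t) (B : Finset ℕ) :
    FF t B = ∏ s ∈ B, ∏ u ∈ hol t B s, ((t : ℂ) / ((s - u : ℕ) : ℂ)) := by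
  have hdiv : ∀ s u : ℕ, u < s → u % t = s % t → ((s - u : ℕ) : ℂ) = t * kk t s u ∧
      kk t s u ≠ 0 := by
    intro s u h1 h2
    refine ⟨?_, kk_ne_zero (by omega)⟩
    rw [kk, if_pos h2]
    have : s - u = t * (((s / t : ℕ) : ℤ) - ((u / t : ℕ) : ℤ)).natAbs := by
      have e1 := Nat.mod_add_div u t
      have e2 := Nat.mod_add_div s t
      have : u / t ≤ s / t := Nat.div_le_div_right h1.le
      rw [← Nat.cast_sub this, Int.natAbs_natCast, Nat.mul_sub]
      omega
    exact_mod_cast this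
  have hfac : ∀ s : ℕ, ∏ u ∈ (range s).filter (fun y => y % t = s % t), kk t s u =
      (((s / t).factorial : ℕ) : ℂ) := by
    intro s
    rw [below_image ht, prod_image (below_inj ht s), ← prod_range_add_one_eq_factorial,
      ← prod_range_reflect (fun x => x + 1)]
    push_cast
    refine prod_congr rfl fun q hq => ?_
    rw [mem_range] at hq
    have e : (s % t + t * q) / t = q := by
      rw [Nat.add_mul_div_left _ _ ht, Nat.div_eq_of_lt (Nat.mod_lt _ ht), zero_add]
    rw [kk, if_pos (by simp), e, ← Nat.cast_sub hq.le, Int.natAbs_natCast]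
    rw [show s / t - q = s / t - 1 - q + 1 by omega]; push_cast; rfl
  unfold FF VV
  rw [← prod_div_distrib]
  refine prod_congr rfl fun s _ => ?_
  have h1 : ∏ y ∈ B with y < s, kk t s y =
      ∏ y ∈ (B.filter (fun y => y % t = s % t)).filter (fun y => y < s), kk t s y := by
    symm
    refine prod_subset (fun x => by simp; tauto) fun x hx hx2 => ?_
    simp only [mem_filter] at hx hx2
    rw [kk, if_neg (by tauto)]
  rw [h1, ← hfac, ← prod_filter_mul_prod_filter_not ((range s).filter _) (· ∈ B), runner_filter,
    ← hol]
  have h2 : ∏ y ∈ (B.filter (fun y => y % t = s % t)).filter (fun y => y < s), kk t s y ≠ 0 :=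
    prod_ne_zero_iff.2 fun y hy => kk_ne_zero (by simp at hy; omega)
  rw [div_mul_eq_div_div, div_self h2, one_div, ← prod_inv_distrib]
  refine prod_congr rfl fun u hu => ?_
  simp only [hol, mem_filter, mem_range] at hu
  obtain ⟨h3, h4⟩ := hdiv s u hu.1.1 hu.1.2
  have : (t : ℂ) ≠ 0 := by exact_mod_cast ht.ne'
  rw [h3]; field_simp

theorem wZ_nonneg {t : ℕ} (ht : 0 < t) (B : Finset ℕ) : 0 ≤ wZ t B := by
  rw [wZ_eq ht]; positivity

theorem TT_neg {N t : ℕ} (ht : 0 < t) {M w : ℤ} (hw : w < 0) : TT N t M w = 0 := by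
  rw [TT]
  refine sum_eq_zero fun B hB => ?_
  have := (mem_SS.1 hB).2.2
  have := wZ_nonneg ht B
  omega

/-- coefficients of the exponential -/
noncomputable def ee (t : ℕ) : ℕ → ℂ
  | 0 => 1
  | 1 => Complex.I
  | n + 2 => (Complex.I * ee t (n + 1) + t * ee t n) / (n + 2)

theorem TT_eq {N t' : ℕ} (hN : 2 * t' + 1 ≤ N) : ∀ (w : ℕ) (M : ℤ), M ≤ b0 N + 2 * N →
    TT N (2 * t' + 1) M w = ee (2 * t' + 1) w * TT N (2 * t' + 1) (M - (2 * t' + 1) * w) 0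
  | 0, M, h => by simp [ee]
  | 1, M, h => by
    have := TT_rec N t' (by omega) M 1 (fun B hB => by
      rw [mem_SS] at hB
      have := wZ_nonneg (t := 2 * t' + 1) (by omega) B
      omega)
    rw [TT_neg (by omega) (show (1 : ℤ) - 2 < 0 by norm_num)] at this
    simpa [ee] using this
  | w + 2, M, h => by
    have h1 := TT_rec N t' (by omega) M (w + 2 : ℕ) (fun B hB => by
      rw [mem_SS] at hB
      refine low_of_energy hN hB.1 ?_
      push_cast
      linarith [hB.2.1])
    rw [show ((w + 2 : ℕ) : ℤ) - 1 = (w + 1 : ℕ) by push_cast; ring,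
      show ((w + 2 : ℕ) : ℤ) - 2 = w by push_cast; ring,
      TT_eq hN (w + 1) _ (by linarith), TT_eq hN w _ (by linarith)] at h1
    rw [ee]
    have h2 : ((w : ℂ) + 2) ≠ 0 := by exact_mod_cast (Nat.succ_ne_zero (w + 1))
    rw [div_mul_eq_mul_div, eq_div_iff h2]
    rw [show M - (2 * (t' : ℤ) + 1) - (2 * t' + 1) * (w + 1 : ℕ) = M - (2 * t' + 1) * (w + 2 : ℕ) by
        push_cast; ring,
      show M - 2 * (2 * (t' : ℤ) + 1) - (2 * t' + 1) * w = M - (2 * t' + 1) * (w + 2 : ℕ) by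
        push_cast; ring] at h1
    push_cast at h1 ⊢
    linear_combination h1

end

section
open Finset

/-- diagram fits in the `N × N` box -/
def Box (N : ℕ) (μ : YoungDiagram) : Prop := ∀ i j, (i, j) ∈ μ → i < N ∧ j < N

theorem box_of_card {N : ℕ} {μ : YoungDiagram} (h : μ.card ≤ N) : Box N μ := by
  intro i j hij
  have h1 : (μ.row i).card ≤ μ.card := card_le_card (filter_subset _ _)
  have h2 : (μ.col j).card ≤ μ.card := card_le_card (filter_subset _ _)
  rw [← YoungDiagram.rowLen_eq_card] at h1
  rw [← YoungDiagram.colLen_eq_card] at h2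
  have h3 := YoungDiagram.mem_iff_lt_rowLen.1 hij
  have h4 := YoungDiagram.mem_iff_lt_colLen.1 hij
  omega

/-- position of the bead of row `i` -/
def sB (N : ℕ) (μ : YoungDiagram) (i : ℕ) : ℕ := μ.rowLen i + N - 1 - i
/-- position of the hole of column `j` -/
def uB (N : ℕ) (μ : YoungDiagram) (j : ℕ) : ℕ := N + j - μ.colLen j
/-- bead set of a diagram -/
def Bd (N : ℕ) (μ : YoungDiagram) : Finset ℕ := (range N).image (sB N μ)

theorem box_row {N : ℕ} {μ : YoungDiagram} (h : Box N μ) (i : ℕ) : μ.rowLen i ≤ N := by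
  by_contra h2
  exact absurd (h i N (YoungDiagram.mem_iff_lt_rowLen.2 (by omega))).2 (lt_irrefl _)

theorem box_col {N : ℕ} {μ : YoungDiagram} (h : Box N μ) (i : ℕ) : μ.colLen i ≤ N := by
  by_contra h2
  exact absurd (h N i (YoungDiagram.mem_iff_lt_colLen.2 (by omega))).1 (lt_irrefl _)

theorem box_transpose {N : ℕ} {μ : YoungDiagram} (h : Box N μ) : Box N μ.transpose := by
  intro i j hij
  rw [YoungDiagram.mem_transpose] at hij
  exact (h _ _ hij).symm

theorem sB_anti {N : ℕ} {μ : YoungDiagram} {i i' : ℕ} (h : i < i') (h' : i' < N) :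
    sB N μ i' < sB N μ i := by
  have := μ.rowLen_anti i i' h.le
  unfold sB; omega

theorem uB_mono {N : ℕ} {μ : YoungDiagram} (hb : Box N μ) {i i' : ℕ} (h : i < i') (_h' : i' < N) :
    uB N μ i < uB N μ i' := by
  have := μ.colLen_anti i i' h.le
  have := box_col hb i
  unfold uB; omega

theorem sB_inj {N : ℕ} {μ : YoungDiagram} {i i' : ℕ} (hi : i < N) (h' : i' < N)
    (h : sB N μ i = sB N μ i') : i = i' := by
  rcases lt_trichotomy i i' with h1 | h1 | h1
  · have := sB_anti (μ := μ) h1 h'; omega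
  · exact h1
  · have := sB_anti (μ := μ) h1 hi; omega

theorem uB_inj {N : ℕ} {μ : YoungDiagram} (hb : Box N μ) {i i' : ℕ} (hi : i < N) (h' : i' < N)
    (h : uB N μ i = uB N μ i') : i = i' := by
  rcases lt_trichotomy i i' with h1 | h1 | h1
  · have := uB_mono hb h1 h'; omega
  · exact h1
  · have := uB_mono hb h1 hi; omega

theorem cell_iff {N : ℕ} {μ : YoungDiagram} (hb : Box N μ) {i j : ℕ} (hi : i < N) (_hj : j < N) :
    ((i, j) ∈ μ ↔ uB N μ j < sB N μ i) ∧ uB N μ j ≠ sB N μ i := by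
  have h1 := @YoungDiagram.mem_iff_lt_rowLen μ i j
  have h2 := @YoungDiagram.mem_iff_lt_colLen μ i j
  have := box_col hb j
  unfold uB sB
  by_cases h : (i, j) ∈ μ
  · have := h1.1 h
    have := h2.1 h
    simp only [h, true_iff]
    omega
  · have : ¬ j < μ.rowLen i := fun h' => h (h1.2 h')
    have : ¬ i < μ.colLen j := fun h' => h (h2.2 h')
    simp only [h, false_iff]
    omega

theorem hook_eq {N : ℕ} {μ : YoungDiagram} (hb : Box N μ) {i j : ℕ} (h : (i, j) ∈ μ) :
    hookLen μ (i, j) = sB N μ i - uB N μ j := by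
  have h1 := (@YoungDiagram.mem_iff_lt_rowLen μ i j).1 h
  have h2 := (@YoungDiagram.mem_iff_lt_colLen μ i j).1 h
  have := box_col hb j
  have := (hb i j h)
  unfold hookLen uB sB
  dsimp only
  omega

theorem mem_Bd {N : ℕ} {μ : YoungDiagram} {p : ℕ} : p ∈ Bd N μ ↔ ∃ i < N, sB N μ i = p := by
  simp [Bd]

theorem card_Bd (N : ℕ) (μ : YoungDiagram) : (Bd N μ).card = N := by
  rw [Bd, card_image_of_injOn, card_range]
  intro a ha b hb h
  simp only [coe_range, Set.mem_Iio] at ha hb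
  exact sB_inj ha hb h

theorem uB_notMem {N : ℕ} {μ : YoungDiagram} (hb : Box N μ) {j : ℕ} (hj : j < N) :
    uB N μ j ∉ Bd N μ := by
  rw [mem_Bd]
  rintro ⟨i, hi, h⟩
  exact (cell_iff hb hi hj).2 h.symm

theorem Bd_lt {N : ℕ} {μ : YoungDiagram} (hb : Box N μ) {p : ℕ} (h : p ∈ Bd N μ) : p < 2 * N := by
  rw [mem_Bd] at h
  obtain ⟨i, hi, rfl⟩ := h
  have := box_row hb i
  unfold sB; omega

theorem hole_iff {N : ℕ} {μ : YoungDiagram} (hb : Box N μ) {p : ℕ} (hp : p < 2 * N) :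
    p ∉ Bd N μ ↔ ∃ j < N, uB N μ j = p := by
  constructor
  · intro h
    have h1 : ((range N).image (uB N μ)).card = N := by
      rw [card_image_of_injOn, card_range]
      intro a ha b hb' h
      simp only [coe_range, Set.mem_Iio] at ha hb'
      exact uB_inj hb ha hb' h
    have h2 : (range N).image (uB N μ) = range (2 * N) \ Bd N μ := by
      apply eq_of_subset_of_card_le
      · intro x hx
        simp only [mem_image, mem_range] at hx
        obtain ⟨j, hj, rfl⟩ := hx
        rw [mem_sdiff, mem_range]
        refine ⟨?_, uB_notMem hb hj⟩
        unfold uB; omega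
      · rw [card_sdiff_of_subset, h1, card_Bd, card_range]
        · omega
        · intro x hx
          rw [mem_range]; exact Bd_lt hb hx
    have h3 : p ∈ range (2 * N) \ Bd N μ := mem_sdiff.2 ⟨mem_range.2 hp, h⟩
    rw [← h2] at h3
    simpa using h3
  · rintro ⟨j, hj, rfl⟩
    exact uB_notMem hb hj

theorem Bd_transpose {N : ℕ} {μ : YoungDiagram} (hb : Box N μ) {p : ℕ} (hp : p < 2 * N) :
    p ∈ Bd N μ.transpose ↔ 2 * N - 1 - p ∉ Bd N μ := by
  rw [hole_iff hb (by omega), mem_Bd]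
  refine exists_congr fun j => and_congr_right fun hj => ?_
  have := box_col hb j
  unfold sB uB
  rw [YoungDiagram.rowLen_transpose]
  omega

theorem Bd_mem_SCN {N : ℕ} {μ : YoungDiagram} (hb : Box N μ) (h : μ.transpose = μ) :
    Bd N μ ∈ SCN N := by
  rw [mem_SCN]
  refine ⟨fun p hp => Bd_lt hb hp, fun p hp => ?_⟩
  rw [← Bd_transpose hb hp, h]

theorem Bd_inj {N : ℕ} {μ ν : YoungDiagram} (hμ : Box N μ) (hν : Box N ν)
    (h : Bd N μ = Bd N ν) : μ = ν := by
  have key : ∀ ρ : YoungDiagram, Bd N ρ = Bd N ν →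
      (fun k : Fin N => sB N ρ (N - 1 - k)) = (Bd N ν).orderEmbOfFin (card_Bd N ν) := by
    intro ρ hρ
    apply orderEmbOfFin_unique
    · intro k
      rw [← hρ, mem_Bd]
      exact ⟨_, by omega, rfl⟩
    · intro k l hkl
      exact sB_anti (by have : (k : ℕ) < l := hkl; omega) (by omega)
  have h1 := (key μ h).trans (key ν rfl).symm
  have h2 : ∀ i < N, μ.rowLen i = ν.rowLen i := by
    intro i hi
    have := congrFun h1 ⟨N - 1 - i, by omega⟩
    dsimp only at this
    rw [show N - 1 - (N - 1 - i) = i by omega] at this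
    unfold sB at this; omega
  ext ⟨i, j⟩
  rw [YoungDiagram.mem_cells, YoungDiagram.mem_cells]
  constructor
  · intro hx
    have := (hμ i j hx).1
    rw [YoungDiagram.mem_iff_lt_rowLen] at hx ⊢
    rwa [← h2 i this]
  · intro hx
    have := (hν i j hx).1
    rw [YoungDiagram.mem_iff_lt_rowLen] at hx ⊢
    rwa [h2 i this]

theorem card_SCN {N : ℕ} {B : Finset ℕ} (hB : B ∈ SCN N) : B.card = N := by
  rw [card_eq_sum_ones, sum_SCN _ hB]
  simp

theorem Bd_surj {N : ℕ} {B : Finset ℕ} (hB : B ∈ SCN N) :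
    ∃ μ : YoungDiagram, Box N μ ∧ μ.transpose = μ ∧ Bd N μ = B := by
  have hc := card_SCN hB
  obtain ⟨h1, h2⟩ := mem_SCN.1 hB
  let f := B.orderEmbOfFin hc
  have hfB : ∀ k, f k ∈ B := fun k => orderEmbOfFin_mem B hc k
  have hfm : StrictMono f := (B.orderEmbOfFin hc).strictMono
  have hfk : ∀ n, ∀ hn : n < N, n ≤ f ⟨n, hn⟩ := by
    intro n
    induction n with
    | zero => intro _; omega
    | succ n ih =>
      intro hn
      have := ih (by omega)
      have h3 : f ⟨n, by omega⟩ < f ⟨n + 1, hn⟩ := hfm (by simp [Fin.lt_def])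
      omega
  have hfd : ∀ k l : Fin N, k ≤ l → (f k : ℤ) - k ≤ f l - l := by
    have : ∀ d, ∀ k, ∀ h : k + d < N, (f ⟨k, by omega⟩ : ℤ) - k ≤ f ⟨k + d, h⟩ - (k + d : ℕ) := by
      intro d
      induction d with
      | zero => intro k h; simp
      | succ d ih =>
        intro k h
        have h3 := ih k (by omega)
        have h4 : f ⟨k + d, by omega⟩ < f ⟨k + (d + 1), h⟩ := hfm (by simp [Fin.lt_def])
        push_cast at h3 ⊢
        omega
    intro k l hkl
    have hkl' : (k : ℕ) ≤ l := hkl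
    have h4 := this (l - k) k (by omega)
    simp only [show (k : ℕ) + (l - k) = l by omega] at h4
    exact h4
  let r : ℕ → ℕ := fun i => if h : i < N then f ⟨N - 1 - i, by omega⟩ + i + 1 - N else 0
  have hr : ∀ i i', i ≤ i' → r i' ≤ r i := by
    intro i i' h
    by_cases h' : i' < N
    · simp only [r, h', show i < N by omega, dif_pos]
      have := hfd ⟨N - 1 - i', by omega⟩ ⟨N - 1 - i, by omega⟩ (by simp [Fin.le_def]; omega)
      push_cast [show i ≤ N - 1 by omega, show i' ≤ N - 1 by omega, show 1 ≤ N by omega,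
        Nat.cast_sub] at this
      omega
    · simp [r, h']
  have hrN : ∀ i, r i ≤ N := by
    intro i
    by_cases h' : i < N
    · have h5 := h1 _ (hfB ⟨N - 1 - 0, by omega⟩)
      refine (hr 0 i (by omega)).trans ?_
      simp only [r, show 0 < N by omega, dif_pos]
      omega
    · simp [r, h']
  let μ : YoungDiagram := ⟨(range N ×ˢ range N).filter (fun c => c.2 < r c.1), by
    rintro ⟨a, b⟩ ⟨c, d⟩ h hab
    have h3 : c ≤ a := h.1
    have h4 : d ≤ b := h.2
    simp only [coe_filter, mem_product, mem_range, Set.mem_ofPred_eq] at hab ⊢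
    have := hr _ _ h3
    omega⟩
  have hmem : ∀ i j, (i, j) ∈ μ ↔ j < r i := by
    intro i j
    rw [show (i, j) ∈ μ ↔ (i, j) ∈ (range N ×ˢ range N).filter (fun c => c.2 < r c.1) from Iff.rfl]
    simp only [mem_filter, mem_product, mem_range]
    constructor
    · exact fun h => h.2
    · intro h
      have := hrN i
      refine ⟨⟨?_, by omega⟩, h⟩
      by_contra h'
      simp [r, h'] at h
  have hrow : ∀ i, μ.rowLen i = r i := by
    intro i
    apply le_antisymm
    · by_contra h
      have := (hmem i (r i)).1 (YoungDiagram.mem_iff_lt_rowLen.2 (by omega))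
      omega
    · by_contra h
      have := YoungDiagram.mem_iff_lt_rowLen.1 ((hmem i (μ.rowLen i)).2 (by omega))
      omega
  have hbox : Box N μ := by
    intro i j h
    have h := (hmem i j).1 h
    have := hrN i
    refine ⟨?_, by omega⟩
    by_contra h'
    simp [r, h'] at h
  have hBd : Bd N μ = B := by
    apply eq_of_subset_of_card_le
    · intro p hp
      obtain ⟨i, hi, rfl⟩ := mem_Bd.1 hp
      have e : sB N μ i = f ⟨N - 1 - i, by omega⟩ := by
        have := hfk (N - 1 - i) (by omega)
        unfold sB
        rw [hrow]
        simp only [r, hi, dif_pos]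
        omega
      rw [e]
      exact hfB _
    · rw [hc, card_Bd]
  refine ⟨μ, hbox, ?_, hBd⟩
  apply Bd_inj (box_transpose hbox) hbox
  ext p
  by_cases hp : p < 2 * N
  · rw [Bd_transpose hbox hp, hBd, ← h2 p hp]
  · constructor
    · intro h; exact absurd (Bd_lt (box_transpose hbox) h) hp
    · intro h; exact absurd (Bd_lt hbox h) hp

theorem sum_Bd {N : ℕ} {μ : YoungDiagram} (hb : Box N μ) :
    ∑ s ∈ Bd N μ, (s : ℤ) = μ.card + b0 N := by
  have h1 : μ.card = ∑ i ∈ range N, μ.rowLen i := by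
    rw [YoungDiagram.card, card_eq_sum_card_fiberwise (f := Prod.fst) (t := range N)]
    · refine sum_congr rfl fun i _ => ?_
      rw [YoungDiagram.rowLen_eq_card]; rfl
    · rintro ⟨i, j⟩ h
      simpa using (hb i j h).1
  rw [Bd, sum_image, h1, b0, ← sum_range_reflect (fun a : ℕ => (a : ℤ))]
  · push_cast
    rw [← sum_add_distrib]
    refine sum_congr rfl fun i hi => ?_
    rw [mem_range] at hi
    unfold sB; omega
  · intro a ha b hb h
    simp only [coe_range, Set.mem_Iio] at ha hb
    exact sB_inj ha hb h

end

section
open Finset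

/-- cells with hook divisible by `t` -/
def TC (t : ℕ) (μ : YoungDiagram) : Finset (ℕ × ℕ) := μ.cells.filter (fun c => t ∣ hookLen μ c)

theorem mem_TC {t : ℕ} {μ : YoungDiagram} {c : ℕ × ℕ} : c ∈ TC t μ ↔ c ∈ μ ∧ t ∣ hookLen μ c := by
  simp [TC]

theorem mem_hol {t : ℕ} {B : Finset ℕ} {s u : ℕ} :
    u ∈ hol t B s ↔ u < s ∧ t ∣ s - u ∧ u ∉ B := by
  simp only [hol, mem_filter, mem_range, and_assoc]
  refine and_congr_right fun h => and_congr_left fun _ => ?_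
  exact (Nat.modEq_iff_dvd' h.le : u ≡ s [MOD t] ↔ _)

theorem TC_image {N t : ℕ} {μ : YoungDiagram} (hb : Box N μ) :
    (TC t μ).image (fun c => (⟨sB N μ c.1, uB N μ c.2⟩ : Σ _ : ℕ, ℕ)) =
      (Bd N μ).sigma (fun s => hol t (Bd N μ) s) := by
  ext ⟨s, u⟩
  simp only [mem_image, mem_sigma, mem_TC, mem_hol]
  constructor
  · rintro ⟨⟨i, j⟩, ⟨h1, h2⟩, h3⟩
    simp only [Sigma.mk.injEq, heq_eq_eq] at h3
    obtain ⟨rfl, rfl⟩ := h3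
    have hij := hb i j h1
    rw [hook_eq hb h1] at h2
    exact ⟨mem_Bd.2 ⟨i, hij.1, rfl⟩, ((cell_iff hb hij.1 hij.2).1).1 h1, h2, uB_notMem hb hij.2⟩
  · rintro ⟨h1, h2, h3, h4⟩
    have := Bd_lt hb h1
    obtain ⟨i, hi, rfl⟩ := mem_Bd.1 h1
    obtain ⟨j, hj, rfl⟩ := (hole_iff hb (by omega)).1 h4
    have hm := ((cell_iff hb hi hj).1).2 h2
    refine ⟨(i, j), ⟨hm, ?_⟩, rfl⟩
    rwa [hook_eq hb hm]

theorem TC_inj {N t : ℕ} {μ : YoungDiagram} (hb : Box N μ) :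
    Set.InjOn (fun c => (⟨sB N μ c.1, uB N μ c.2⟩ : Σ _ : ℕ, ℕ)) (TC t μ : Set (ℕ × ℕ)) := by
  rintro ⟨i, j⟩ h ⟨i', j'⟩ h' e
  rw [mem_coe, mem_TC] at h h'
  simp only [Sigma.mk.injEq, heq_eq_eq] at e
  have h1 := hb _ _ h.1
  have h2 := hb _ _ h'.1
  rw [sB_inj h1.1 h2.1 e.1, uB_inj hb h1.2 h2.2 e.2]

theorem TC_card {N t : ℕ} (ht : 0 < t) {μ : YoungDiagram} (hb : Box N μ) :
    ((TC t μ).card : ℤ) = wZ t (Bd N μ) := by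
  rw [wZ_eq ht, ← card_image_of_injOn (TC_inj hb), TC_image hb, card_sigma]
  push_cast; rfl

theorem TC_prod {N t : ℕ} (ht : 0 < t) {μ : YoungDiagram} (hb : Box N μ) :
    ∏ c ∈ TC t μ, ((t : ℂ) / (hookLen μ c : ℂ)) = FF t (Bd N μ) := by
  rw [FF_eq ht, prod_sigma' (f := fun s u => ((t : ℂ) / ((s - u : ℕ) : ℂ))), ← TC_image hb,
    prod_image (TC_inj hb)]
  refine prod_congr rfl fun c hc => ?_
  obtain ⟨i, j⟩ := c
  rw [hook_eq hb (mem_TC.1 hc).1]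

theorem hook_swap {μ : YoungDiagram} (h : μ.transpose = μ) (c : ℕ × ℕ) :
    hookLen μ c.swap = hookLen μ c := by
  have h1 : ∀ i, μ.rowLen i = μ.colLen i := fun i => by
    conv_lhs => rw [← h]
    rw [YoungDiagram.rowLen_transpose]
  unfold hookLen
  rw [Prod.fst_swap, Prod.snd_swap, h1, h1]
  omega

theorem TC_swap {t : ℕ} {μ : YoungDiagram} (h : μ.transpose = μ) {c : ℕ × ℕ} (hc : c ∈ TC t μ) :
    c.swap ∈ TC t μ := by
  rw [mem_TC] at hc ⊢
  rw [hook_swap h, ← YoungDiagram.mem_transpose, h]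
  exact hc

theorem TC_split {t : ℕ} {μ : YoungDiagram} (h : μ.transpose = μ) :
    (TC t μ).card = ((TC t μ).filter (fun c => c.1 = c.2)).card +
      2 * ((TC t μ).filter (fun c => c.2 < c.1)).card := by
  have h1 : ((TC t μ).filter (fun c => c.2 < c.1)).card =
      ((TC t μ).filter (fun c => c.1 < c.2)).card := by
    refine card_bij (fun c _ => c.swap) ?_ ?_ ?_
    · intro c hc
      rw [mem_filter] at hc ⊢
      exact ⟨TC_swap h hc.1, hc.2⟩
    · intro a _ b _ e; exact Prod.swap_injective e
    · intro c hc
      rw [mem_filter] at hc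
      exact ⟨c.swap, by rw [mem_filter]; exact ⟨TC_swap h hc.1, hc.2⟩, Prod.swap_swap c⟩
  have h2 : (TC t μ).card = ((TC t μ).filter (fun c => c.1 = c.2)).card +
      (((TC t μ).filter (fun c => c.2 < c.1)).card + ((TC t μ).filter (fun c => c.1 < c.2)).card) := by
    rw [← card_filter_add_card_filter_not (s := TC t μ) (fun c => c.1 = c.2),
      ← card_filter_add_card_filter_not (s := (TC t μ).filter (fun c => ¬ c.1 = c.2)) (fun c => c.2 < c.1),
      filter_filter, filter_filter]
    congr 3
    · ext c; simp only [mem_filter]; constructor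
      · rintro ⟨a, b, c⟩; exact ⟨a, c⟩
      · rintro ⟨a, b⟩; exact ⟨a, by omega, b⟩
    · ext c; simp only [mem_filter]; constructor
      · rintro ⟨a, b, c⟩; exact ⟨a, by omega⟩
      · rintro ⟨a, b⟩; exact ⟨a, by omega, by omega⟩
  omega

theorem TC_diag {N t : ℕ} {μ : YoungDiagram} (hb : Box N μ) (h : μ.transpose = μ) :
    ((TC t μ).filter (fun c => c.1 = c.2)).card =
      ((Bd N μ).filter (fun s => N ≤ s ∧ t ∣ 2 * s + 1 - 2 * N)).card := by
  have h1 : ∀ i, μ.rowLen i = μ.colLen i := fun i => by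
    conv_lhs => rw [← h]
    rw [YoungDiagram.rowLen_transpose]
  have key : ∀ i < N, uB N μ i = 2 * N - 1 - sB N μ i := by
    intro i hi
    have := box_col hb i
    unfold uB sB
    rw [h1]; omega
  have hlt : ∀ i < N, sB N μ i < 2 * N := fun i hi => Bd_lt hb (mem_Bd.2 ⟨i, hi, rfl⟩)
  refine card_bij (fun c _ => sB N μ c.1) ?_ ?_ ?_
  · rintro ⟨i, j⟩ hc
    rw [mem_filter, mem_TC] at hc
    obtain ⟨⟨h2, h3⟩, h4⟩ := hc
    dsimp only at h4
    subst h4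
    have hi := (hb _ _ h2).1
    have h5 := ((cell_iff hb hi hi).1).1 h2
    rw [hook_eq hb h2] at h3
    have h6 := key i hi
    have h7 := hlt i hi
    rw [mem_filter, mem_Bd]
    dsimp only
    refine ⟨⟨i, hi, rfl⟩, by omega, ?_⟩
    convert h3 using 1
    omega
  · rintro ⟨i, j⟩ hc ⟨i', j'⟩ hc' e
    rw [mem_filter, mem_TC] at hc hc'
    obtain ⟨⟨h2, h3⟩, h4⟩ := hc
    obtain ⟨⟨h2', h3'⟩, h4'⟩ := hc'
    dsimp only at h4 h4' e
    subst h4 h4'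
    rw [sB_inj (hb _ _ h2).1 (hb _ _ h2').1 e]
  · intro s hs
    rw [mem_filter, mem_Bd] at hs
    obtain ⟨⟨i, hi, rfl⟩, h2, h3⟩ := hs
    have h6 := key i hi
    have h7 := hlt i hi
    have hm : (i, i) ∈ μ := ((cell_iff hb hi hi).1).2 (by omega)
    refine ⟨(i, i), ?_, rfl⟩
    rw [mem_filter, mem_TC]
    refine ⟨⟨hm, ?_⟩, rfl⟩
    rw [hook_eq hb hm]
    convert h3 using 1
    omega

theorem sg_eq (N t : ℕ) (B : Finset ℕ) : sg N t B = (-1) ^ (∑ s ∈ B, s) *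
    (-Complex.I) ^ (B.filter (fun s => N ≤ s ∧ t ∣ 2 * s + 1 - 2 * N)).card := by
  unfold sg chi
  rw [prod_mul_distrib, prod_pow_eq_pow_sum, ← prod_filter, prod_const]

theorem neg_one_pow_durfee {μ : YoungDiagram} (h : μ.transpose = μ) :
    (-1 : ℂ) ^ durfee μ = (-1) ^ μ.card := by
  have h1 := TC_split (t := 1) h
  have h2 : TC 1 μ = μ.cells := by ext c; simp [mem_TC]
  rw [h2] at h1
  rw [durfee, YoungDiagram.card, h1, pow_add, pow_mul]
  simp

theorem weight_eq {N t : ℕ} (ht : 0 < t) (hN : Even (b0 N)) {μ : YoungDiagram} (hb : Box N μ)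
    (h : μ.transpose = μ) (b : ℂ) :
    (-1) ^ durfee μ * ∏ c ∈ μ.cells.filter (fun c => t ∣ hookLen μ c),
        (b * t / ((hookLen μ c : ℂ) * eps c)) =
    (Complex.I * b) ^ (wZ t (Bd N μ)).toNat * (sg N t (Bd N μ) * FF t (Bd N μ)) := by
  have h1 : ∏ c ∈ μ.cells.filter (fun c => t ∣ hookLen μ c),
        (b * t / ((hookLen μ c : ℂ) * eps c)) =
      b ^ (TC t μ).card * FF t (Bd N μ) * (-1) ^ ((TC t μ).filter (fun c => c.2 < c.1)).card := by
    rw [← TC_prod ht hb, ← prod_const, ← prod_const, prod_filter (s := TC t μ),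
      ← prod_mul_distrib, ← prod_mul_distrib]
    refine prod_congr rfl fun c _ => ?_
    unfold eps
    split_ifs
    · rw [mul_neg_one, div_neg]; ring
    · ring
  have h2 : (wZ t (Bd N μ)).toNat = (TC t μ).card := by rw [← TC_card ht hb]; simp
  have h3 : (-1 : ℂ) ^ (∑ s ∈ Bd N μ, s) = (-1) ^ μ.card := by
    obtain ⟨k, hk⟩ := hN
    have h4 := sum_Bd hb
    rw [hk] at h4
    rw [← zpow_natCast, ← zpow_natCast]
    push_cast
    rw [h4, zpow_add₀ (by norm_num), ← two_mul, zpow_mul]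
    norm_num
  rw [h1, h2, sg_eq, h3, neg_one_pow_durfee h, ← TC_diag hb h, mul_pow, TC_split (t := t) h]
  generalize ((TC t μ).filter (fun c => c.1 = c.2)).card = D
  generalize ((TC t μ).filter (fun c => c.2 < c.1)).card = L
  have h5 : Complex.I ^ (D + 2 * L) * (-Complex.I) ^ D = (-1) ^ L := by
    rw [pow_add, pow_mul, Complex.I_sq, mul_right_comm, ← mul_pow]
    simp
  rw [← h5]
  ring

theorem wZ_le {N t : ℕ} (ht : 0 < t) {μ : YoungDiagram} (hb : Box N μ) :
    wZ t (Bd N μ) ≤ μ.card := by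
  rw [← TC_card ht hb]
  exact_mod_cast card_le_card (filter_subset _ _)

theorem coeff_lhs {N t : ℕ} (ht : 0 < t) (hN : Even (b0 N)) (b : ℂ) (d : ℕ) (hd : d ≤ N) :
    HasSum (fun μ : {μ : YoungDiagram // μ.transpose = μ} => if μ.1.card = d then
      ((-1) ^ durfee μ.1 * ∏ c ∈ μ.1.cells.filter (fun c => t ∣ hookLen μ.1 c),
        (b * t / ((hookLen μ.1 c : ℂ) * eps c))) else 0)
    (∑ w ∈ range (d + 1), (Complex.I * b) ^ w * TT N t (d + b0 N) w) := by
  classical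
  choose! f hf1 hf2 hf3 using fun (B : Finset ℕ) (hB : B ∈ SCN N) => Bd_surj hB
  let Q := (SCN N).filter (fun B : Finset ℕ => ∑ s ∈ B, (s : ℤ) = d + b0 N)
  let φ : Q → {μ : YoungDiagram // μ.transpose = μ} := fun B =>
    ⟨f B.1, hf2 _ (mem_filter.1 B.2).1⟩
  have hcard : ∀ B : Q, (φ B).1.card = d := by
    intro B
    have hB := mem_filter.1 B.2
    have := sum_Bd (hf1 _ hB.1)
    rw [hf3 _ hB.1, hB.2] at this
    simp only [φ]
    omega
  have e1 : ∑ w ∈ range (d + 1), (Complex.I * b) ^ w * TT N t (d + b0 N) w =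
      ∑ B ∈ Q, (Complex.I * b) ^ (wZ t B).toNat * (sg N t B * FF t B) := by
    have hm : ∀ B ∈ Q, (wZ t B).toNat ∈ range (d + 1) := by
      intro B hB
      have h1 := hcard ⟨B, hB⟩
      simp only [φ] at h1
      have hB := mem_filter.1 hB
      have := wZ_le ht (hf1 _ hB.1)
      rw [hf3 _ hB.1] at this
      rw [mem_range]; omega
    rw [← sum_fiberwise_of_maps_to hm]
    refine sum_congr rfl fun w _ => ?_
    rw [TT, mul_sum]
    refine sum_congr ?_ ?_
    · ext B
      simp only [Q, mem_SS, mem_filter, and_assoc]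
      have := wZ_nonneg ht B
      refine and_congr_right fun _ => and_congr_right fun _ => ?_
      omega
    · intro B hB
      rw [(mem_filter.1 hB).2]
  rw [e1, ← sum_attach]
  have e2 : ∑ B ∈ Q.attach, (Complex.I * b) ^ (wZ t B.1).toNat * (sg N t B.1 * FF t B.1) =
      ∑ μ ∈ Q.attach.image φ, if μ.1.card = d then
      ((-1) ^ durfee μ.1 * ∏ c ∈ μ.1.cells.filter (fun c => t ∣ hookLen μ.1 c),
        (b * t / ((hookLen μ.1 c : ℂ) * eps c))) else 0 := by
    rw [sum_image]
    · refine sum_congr rfl fun B _ => ?_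
      have hB := mem_filter.1 B.2
      rw [if_pos (hcard B), weight_eq ht hN (hf1 _ hB.1) (hf2 _ hB.1), hf3 _ hB.1]
    · intro B _ B' _ h
      simp only [φ, Subtype.mk.injEq] at h
      have hB := mem_filter.1 B.2
      have hB' := mem_filter.1 B'.2
      apply Subtype.ext
      rw [← hf3 _ hB.1, h, hf3 _ hB'.1]
  rw [e2]
  apply hasSum_sum_of_ne_finset_zero
  intro μ hμ
  rw [if_neg]
  intro h
  apply hμ
  have hb : Box N μ.1 := box_of_card (by omega)
  have hS := Bd_mem_SCN hb μ.2
  rw [mem_image]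
  refine ⟨⟨Bd N μ.1, mem_filter.2 ⟨hS, ?_⟩⟩, mem_attach _ _, ?_⟩
  · rw [sum_Bd hb, h]
  · apply Subtype.ext
    exact Bd_inj (hf1 _ hS) hb (hf3 _ hS)

end

section
open Finset

theorem hol_empty {t : ℕ} (ht : 0 < t) {B : Finset ℕ} (h : wZ t B = 0) :
    ∀ s ∈ B, hol t B s = ∅ := by
  rw [wZ_eq ht] at h
  have h' : ∑ s ∈ B, (hol t B s).card = 0 := by exact_mod_cast h
  rw [sum_eq_zero_iff] at h'
  intro s hs
  exact card_eq_zero.1 (h' s hs)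

theorem mem_hol' {t : ℕ} {B : Finset ℕ} {s u : ℕ} :
    u ∈ hol t B s ↔ u < s ∧ u % t = s % t ∧ u ∉ B := by
  simp only [hol, mem_filter, mem_range, and_assoc]

theorem FF_core {t : ℕ} (ht : 0 < t) {B : Finset ℕ} (h : wZ t B = 0) : FF t B = 1 := by
  rw [FF_eq ht]
  refine prod_eq_one fun s hs => ?_
  rw [hol_empty ht h s hs, prod_empty]

theorem sg_core {N t : ℕ} (ht : 0 < t) {B : Finset ℕ} (hB : B ∈ SCN N) (h : wZ t B = 0) :
    sg N t B = (-1) ^ (∑ s ∈ B, s) := by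
  unfold sg chi
  rw [prod_mul_distrib, prod_pow_eq_pow_sum]
  rw [prod_eq_one, mul_one]
  intro s hs
  rw [if_neg]
  rintro ⟨h1, h2⟩
  have h3 := (mem_SCN.1 hB).1 s hs
  have h4 := ((mem_SCN.1 hB).2 s h3).1 hs
  have h5 : 2 * N - 1 - s ∈ hol t B s := by
    rw [mem_hol']
    refine ⟨by omega, ?_, h4⟩
    refine (Nat.modEq_iff_dvd' (by omega)).2 ?_
    convert h2 using 1
    omega
  rw [hol_empty ht h s hs] at h5
  simp at h5

/-- core with given runner heights -/
def corB (N t : ℕ) (n : ℕ → ℕ) : Finset ℕ := (range (2 * N)).filter (fun s => s / t < n (s % t))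

theorem mem_corB {K t : ℕ} (ht : 0 < t) {n : ℕ → ℕ} (hn : ∀ c < t, n c ≤ 2 * K) {s : ℕ} :
    s ∈ corB (t * K) t n ↔ s / t < n (s % t) := by
  rw [corB, mem_filter, mem_range, and_iff_right_iff_imp]
  intro h
  have h1 := hn (s % t) (Nat.mod_lt _ ht)
  rw [show 2 * (t * K) = (2 * K) * t by ring]
  exact (Nat.div_lt_iff_lt_mul ht).1 (by omega)

/-- sum of positions on a runner -/
def hh (t c n : ℕ) : ℤ := ∑ q ∈ range n, ((c : ℤ) + t * q)

theorem two_hh (t c n : ℕ) : 2 * hh t c n = 2 * c * n + t * (n * (n - 1)) := by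
  induction n with
  | zero => simp [hh]
  | succ n ih =>
    rw [hh, sum_range_succ, ← hh, mul_add, ih]; push_cast; ring

theorem div_mod_lin {t c : ℕ} (hc : c < t) (q : ℕ) : (c + t * q) / t = q ∧ (c + t * q) % t = c := by
  have ht : 0 < t := by omega
  rw [Nat.add_mul_div_left _ _ ht, Nat.div_eq_of_lt hc, Nat.add_mul_mod_self_left,
    Nat.mod_eq_of_lt hc, zero_add]
  exact ⟨rfl, rfl⟩

theorem sum_corB {K t : ℕ} (ht : 0 < t) {n : ℕ → ℕ} (hn : ∀ c < t, n c ≤ 2 * K) :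
    ∑ s ∈ corB (t * K) t n, (s : ℤ) = ∑ c ∈ range t, hh t c (n c) := by
  rw [← sum_fiberwise_of_maps_to (s := corB (t * K) t n) (t := range t) (g := fun s => s % t)
    (fun s _ => mem_range.2 (Nat.mod_lt s ht))]
  refine sum_congr rfl fun c hc => ?_
  rw [mem_range] at hc
  have : (corB (t * K) t n).filter (fun s => s % t = c) = (range (n c)).image (fun q => c + t * q) := by
    ext s
    simp only [mem_filter, mem_corB ht hn, mem_image, mem_range]
    constructor
    · rintro ⟨h1, rfl⟩
      exact ⟨s / t, h1, Nat.mod_add_div s t⟩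
    · rintro ⟨q, hq, rfl⟩
      obtain ⟨e1, e2⟩ := div_mod_lin hc q
      rw [e1, e2]; exact ⟨hq, rfl⟩
  rw [this, sum_image, hh]
  · push_cast; rfl
  · intro a _ b _ h
    simp only [add_right_inj] at h
    exact Nat.eq_of_mul_eq_mul_left ht h

theorem b0_eq {K t : ℕ} (ht : 0 < t) : b0 (t * K) = ∑ c ∈ range t, hh t c K := by
  rw [← sum_corB (K := K) ht (n := fun _ => K) (fun _ _ => by omega), b0]
  refine sum_congr ?_ fun _ _ => rfl
  ext s
  rw [mem_corB ht (fun _ _ => by omega), mem_range, Nat.div_lt_iff_lt_mul ht, mul_comm]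

/-- exponent of the theta series -/
def EE (t r : ℕ) (m : ℤ) : ℤ := t * m ^ 2 + (2 * r + 1 - t) * m

/-- heights from charges -/
def nf (K t' : ℕ) (f : Fin t' → ℤ) (c : ℕ) : ℕ :=
  if h : c < t' then (K + f ⟨c, h⟩).toNat else
    if h : 2 * t' - c < t' then (K - f ⟨2 * t' - c, h⟩).toNat else K

section
variable {K t' : ℕ} {f : Fin t' → ℤ}

theorem nf_lo (hf : ∀ r, f r ∈ Icc (-(K : ℤ)) K) (r : Fin t') : (nf K t' f r : ℤ) = K + f r := by
  have h := mem_Icc.1 (hf r)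
  simp only [nf, r.2, dif_pos]
  rw [Int.toNat_of_nonneg (by linarith)]

theorem nf_hi (hf : ∀ r, f r ∈ Icc (-(K : ℤ)) K) (r : Fin t') :
    (nf K t' f (2 * t' - r) : ℤ) = K - f r := by
  have h := mem_Icc.1 (hf r)
  have h2 : 2 * t' - (2 * t' - (r : ℕ)) = r := by omega
  simp only [nf, h2, r.2, dif_pos]
  rw [dif_neg (by omega)]
  rw [Int.toNat_of_nonneg (by linarith)]

theorem nf_mid : nf K t' f t' = K := by
  simp only [nf, lt_irrefl, dif_neg, not_false_iff]
  rw [dif_neg (by omega)]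

theorem nf_cases {P : ℕ → Prop} (h1 : ∀ r : Fin t', P r) (h2 : ∀ r : Fin t', P (2 * t' - r))
    (h3 : P t') : ∀ c < 2 * t' + 1, P c := by
  intro c hc
  rcases lt_trichotomy c t' with h | h | h
  · exact h1 ⟨c, h⟩
  · rw [h]; exact h3
  · have := h2 ⟨2 * t' - c, by omega⟩
    simpa [show 2 * t' - (2 * t' - c) = c by omega] using this

theorem nf_sym (hf : ∀ r, f r ∈ Icc (-(K : ℤ)) K) :
    ∀ c < 2 * t' + 1, nf K t' f c + nf K t' f (2 * t' - c) = 2 * K := by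
  apply nf_cases
  · intro r; have := nf_lo hf r; have := nf_hi hf r; omega
  · intro r; have := nf_lo hf r; have := nf_hi hf r
    rw [show 2 * t' - (2 * t' - (r : ℕ)) = r by omega]; omega
  · rw [show 2 * t' - t' = t' by omega, nf_mid]; omega

theorem nf_le (hf : ∀ r, f r ∈ Icc (-(K : ℤ)) K) :
    ∀ c < 2 * t' + 1, nf K t' f c ≤ 2 * K := by
  intro c hc
  have := nf_sym hf c hc
  omega

theorem refl_div_mod {t K p : ℕ} (ht : 0 < t) (hp : p < 2 * (t * K)) :
    (2 * (t * K) - 1 - p) % t = t - 1 - p % t ∧ (2 * (t * K) - 1 - p) / t = 2 * K - 1 - p / t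
      ∧ p / t < 2 * K := by
  have h1 : p / t < 2 * K := (Nat.div_lt_iff_lt_mul ht).2 (by rw [show 2 * K * t = 2 * (t * K) by ring]; exact hp)
  have h2 := Nat.mod_lt p ht
  have h3 : 2 * (t * K) - 1 - p = (t - 1 - p % t) + t * (2 * K - 1 - p / t) := by
    have h4 := Nat.mod_add_div p t
    obtain ⟨k, hk⟩ : ∃ k, 2 * K = p / t + 1 + k := ⟨2 * K - 1 - p / t, by omega⟩
    have h5 : 2 * (t * K) = t * (p / t) + t + t * k := by
      rw [show 2 * (t * K) = t * (2 * K) by ring, hk]; ring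
    rw [show 2 * K - 1 - p / t = k by omega]
    omega
  rw [h3]
  obtain ⟨e1, e2⟩ := div_mod_lin (t := t) (c := t - 1 - p % t) (by omega) (2 * K - 1 - p / t)
  exact ⟨e2, e1, h1⟩

theorem corB_SCN (hf : ∀ r, f r ∈ Icc (-(K : ℤ)) K) :
    corB ((2 * t' + 1) * K) (2 * t' + 1) (nf K t' f) ∈ SCN ((2 * t' + 1) * K) := by
  rw [mem_SCN]
  refine ⟨fun p hp => mem_range.1 (mem_filter.1 hp).1, fun p hp => ?_⟩
  rw [mem_corB (by omega) (nf_le hf), mem_corB (by omega) (nf_le hf)]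
  obtain ⟨e1, e2, e3⟩ := refl_div_mod (by omega) hp
  rw [e1, e2, show 2 * t' + 1 - 1 = 2 * t' by omega]
  have := nf_sym hf (p % (2 * t' + 1)) (Nat.mod_lt _ (by omega))
  omega

theorem corB_wZ (hf : ∀ r, f r ∈ Icc (-(K : ℤ)) K) :
    wZ (2 * t' + 1) (corB ((2 * t' + 1) * K) (2 * t' + 1) (nf K t' f)) = 0 := by
  rw [wZ_eq (by omega)]
  refine sum_eq_zero fun s hs => ?_
  rw [Nat.cast_eq_zero, card_eq_zero, eq_empty_iff_forall_notMem]
  intro u hu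
  rw [mem_hol', mem_corB (by omega) (nf_le hf)] at hu
  rw [mem_corB (by omega) (nf_le hf)] at hs
  obtain ⟨h1, h2, h3⟩ := hu
  rw [h2] at h3
  have := Nat.div_le_div_right (c := 2 * t' + 1) h1.le
  omega

theorem corB_sum (hf : ∀ r, f r ∈ Icc (-(K : ℤ)) K) :
    ∑ s ∈ corB ((2 * t' + 1) * K) (2 * t' + 1) (nf K t' f), (s : ℤ) =
      ∑ r : Fin t', EE (2 * t' + 1) r (f r) + b0 ((2 * t' + 1) * K) := by
  rw [sum_corB (by omega) (nf_le hf), b0_eq (by omega), ← sub_eq_iff_eq_add, ← sum_sub_distrib]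
  rw [show range (2 * t' + 1) = range (t' + (1 + t')) by congr 1; omega, sum_range_add, sum_range_add,
    sum_range_one, ← sum_range_reflect (fun x => hh (2 * t' + 1) (t' + (1 + x)) (nf K t' f (t' + (1 + x))) -
      hh (2 * t' + 1) (t' + (1 + x)) K) t', add_zero, nf_mid, sub_self, zero_add,
    ← sum_add_distrib, ← Fin.sum_univ_eq_sum_range (fun i => _)]
  refine sum_congr rfl fun r _ => ?_
  have hr : (t' + (1 + (t' - 1 - (r : ℕ)))) = 2 * t' - r := by omega
  have e1 := nf_lo hf r
  have e2 := nf_hi hf r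
  rw [hr]
  have h1 := two_hh (2 * t' + 1) r (nf K t' f r)
  have h2 := two_hh (2 * t' + 1) (2 * t' - r) (nf K t' f (2 * t' - r))
  have h3 := two_hh (2 * t' + 1) r K
  have h4 := two_hh (2 * t' + 1) (2 * t' - r) K
  have e3 : ((2 * t' - (r : ℕ) : ℕ) : ℤ) = 2 * t' - r := by
    have := r.2
    rw [Nat.cast_sub (by omega)]; push_cast; rfl
  rw [e1] at h1
  rw [e2, e3] at h2
  rw [e3] at h4
  unfold EE
  have : ∀ x y : ℤ, 2 * x = 2 * y → x = y := by intro x y h; omega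
  apply this
  push_cast at *
  linear_combination h1 + h2 - h3 - h4

theorem corB_inj {f' : Fin t' → ℤ} (hf : ∀ r, f r ∈ Icc (-(K : ℤ)) K)
    (hf' : ∀ r, f' r ∈ Icc (-(K : ℤ)) K)
    (h : corB ((2 * t' + 1) * K) (2 * t' + 1) (nf K t' f) =
      corB ((2 * t' + 1) * K) (2 * t' + 1) (nf K t' f')) : f = f' := by
  funext r
  have h1 := nf_lo hf r
  have h2 := nf_lo hf' r
  have key : ∀ q, q < nf K t' f r ↔ q < nf K t' f' r := by
    intro q
    obtain ⟨e1, e2⟩ := div_mod_lin (t := 2 * t' + 1) (c := r) (by omega) q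
    have := congrArg (fun B => (r : ℕ) + (2 * t' + 1) * q ∈ B) h
    simp only [mem_corB (show 0 < 2 * t' + 1 by omega) (nf_le hf),
      mem_corB (show 0 < 2 * t' + 1 by omega) (nf_le hf'), e1, e2] at this
    rw [this]
  have h3 := key (nf K t' f r)
  have h4 := key (nf K t' f' r)
  omega

theorem corB_surj {B : Finset ℕ} (hB : B ∈ SCN ((2 * t' + 1) * K)) (hw : wZ (2 * t' + 1) B = 0) :
    ∃ f : Fin t' → ℤ, (∀ r, f r ∈ Icc (-(K : ℤ)) K) ∧
      corB ((2 * t' + 1) * K) (2 * t' + 1) (nf K t' f) = B := by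
  have hol0 := hol_empty (by omega) hw
  obtain ⟨hB1, hB2⟩ := mem_SCN.1 hB
  have hex : ∀ c, ∃ q, c + (2 * t' + 1) * q ∉ B := by
    intro c
    refine ⟨2 * K, fun h => ?_⟩
    have := hB1 _ h
    rw [show 2 * ((2 * t' + 1) * K) = (2 * t' + 1) * (2 * K) by ring] at this
    omega
  let n : ℕ → ℕ := fun c => Nat.find (hex c)
  have hn : ∀ c < 2 * t' + 1, ∀ q, c + (2 * t' + 1) * q ∈ B ↔ q < n c := by
    intro c hc q
    constructor
    · intro h
      by_contra h2
      have h3 := Nat.find_spec (hex c)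
      have h4 : (c + (2 * t' + 1) * n c) ∈ hol (2 * t' + 1) B (c + (2 * t' + 1) * q) := by
        rw [mem_hol']
        refine ⟨?_, by rw [(div_mod_lin hc _).2, (div_mod_lin hc _).2], h3⟩
        have h5 : n c ≠ q := by
          intro h6; rw [← h6] at h; exact h3 h
        have : n c < q := by omega
        have := Nat.mul_lt_mul_of_pos_left this (show 0 < 2 * t' + 1 by omega)
        omega
      rw [hol0 _ h] at h4
      simp at h4
    · intro h
      have := Nat.find_min (hex c) h
      tauto
  have hmem : ∀ s, s ∈ B ↔ s / (2 * t' + 1) < n (s % (2 * t' + 1)) := by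
    intro s
    rw [← hn _ (Nat.mod_lt _ (by omega)), Nat.mod_add_div]
  have hle : ∀ c < 2 * t' + 1, n c ≤ 2 * K := by
    intro c hc
    by_contra h
    have := hB1 _ ((hn c hc (2 * K)).2 (by omega))
    rw [show 2 * ((2 * t' + 1) * K) = (2 * t' + 1) * (2 * K) by ring] at this
    omega
  have hsym : ∀ c < 2 * t' + 1, n c + n (2 * t' - c) = 2 * K := by
    intro c hc
    have key : ∀ q < 2 * K, (q < n c ↔ ¬ (2 * K - 1 - q < n (2 * t' - c))) := by
      intro q hq
      have hp : c + (2 * t' + 1) * q < 2 * ((2 * t' + 1) * K) := by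
        have := Nat.mul_le_mul_left (2 * t' + 1) (show q + 1 ≤ 2 * K by omega)
        rw [show 2 * ((2 * t' + 1) * K) = (2 * t' + 1) * (2 * K) by ring]
        rw [mul_add] at this
        omega
      have h1 := hB2 _ hp
      rw [hmem, hmem] at h1
      obtain ⟨e1, e2, e3⟩ := refl_div_mod (by omega) hp
      obtain ⟨e4, e5⟩ := div_mod_lin hc q
      rw [e1, e2, e4, e5] at h1
      exact h1
    have h1 := hle c hc
    have h2 := hle (2 * t' - c) (by omega)
    by_contra hne
    rcases Nat.lt_or_ge (n c) (2 * K - n (2 * t' - c)) with h | h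
    · have := key (n c) (by omega)
      omega
    · have := key (2 * K - n (2 * t' - c)) (by omega)
      omega
  have hf : ∀ r : Fin t', (n r : ℤ) - K ∈ Icc (-(K : ℤ)) K := by
    intro r
    have := hle r (by omega)
    rw [mem_Icc]; omega
  refine ⟨fun r => n r - K, hf, ?_⟩
  have hnn : ∀ c < 2 * t' + 1, nf K t' (fun r : Fin t' => (n r : ℤ) - K) c = n c := by
    apply nf_cases
    · intro r; have := nf_lo hf r; omega
    · intro r; have := nf_hi hf r; have := hsym r (by omega); omega
    · rw [nf_mid]; have := hsym t' (by omega)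
      rw [show 2 * t' - t' = t' by omega] at this
      omega
  ext s
  rw [mem_corB (by omega) (nf_le hf), hmem, hnn _ (Nat.mod_lt _ (by omega))]

end

theorem EE_nonneg {t r : ℕ} (hr : r < t) (m : ℤ) : 0 ≤ EE t r m := by
  unfold EE
  have h : ((r : ℤ) + 1 ≤ t) := by exact_mod_cast hr
  rcases le_or_gt 0 m with hm | hm
  · rcases hm.eq_or_lt with h0 | h0
    · rw [← h0]; simp
    · nlinarith [mul_nonneg (show (0 : ℤ) ≤ t by positivity) (mul_nonneg hm (show 0 ≤ m - 1 by omega)),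
        mul_nonneg (show (0 : ℤ) ≤ r by positivity) hm]
  · nlinarith [mul_nonneg (show (0 : ℤ) ≤ t by positivity) (mul_nonneg (show 0 ≤ -m by omega) (show 0 ≤ -m - 1 by omega)),
        mul_nonneg (show (0 : ℤ) ≤ t - r - 1 by linarith) (show 0 ≤ -m by omega)]

theorem TT_core (K t' : ℕ) (hb : Even (b0 ((2 * t' + 1) * K))) (d : ℤ) :
    TT ((2 * t' + 1) * K) (2 * t' + 1) (d + b0 ((2 * t' + 1) * K)) 0 =
      ∑ f ∈ Fintype.piFinset (fun _ : Fin t' => Icc (-(K : ℤ)) K),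
        if ∑ r : Fin t', EE (2 * t' + 1) r (f r) = d then (-1) ^ d.toNat else 0 := by
  rw [← sum_filter, TT]
  symm
  refine sum_bij (fun f _ => corB ((2 * t' + 1) * K) (2 * t' + 1) (nf K t' f)) ?_ ?_ ?_ ?_
  · intro f hf
    rw [mem_filter, Fintype.mem_piFinset] at hf
    rw [mem_SS]
    refine ⟨corB_SCN hf.1, ?_, corB_wZ hf.1⟩
    rw [corB_sum hf.1, hf.2]
  · intro f hf f' hf' h
    rw [mem_filter, Fintype.mem_piFinset] at hf hf'
    exact corB_inj hf.1 hf'.1 h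
  · intro B hB
    rw [mem_SS] at hB
    obtain ⟨f, hf, rfl⟩ := corB_surj hB.1 hB.2.2
    refine ⟨f, ?_, rfl⟩
    rw [mem_filter, Fintype.mem_piFinset]
    refine ⟨hf, ?_⟩
    have := hB.2.1
    rw [corB_sum hf] at this
    linarith
  · intro f hf
    rw [mem_filter, Fintype.mem_piFinset] at hf
    rw [FF_core (by omega) (corB_wZ hf.1), mul_one, sg_core (by omega) (corB_SCN hf.1) (corB_wZ hf.1)]
    have h1 := corB_sum hf.1
    rw [hf.2] at h1
    have h2 : 0 ≤ d := by
      rw [← hf.2]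
      exact sum_nonneg fun r _ => EE_nonneg (by omega) _
    obtain ⟨k, hk⟩ := hb
    rw [← zpow_natCast, ← zpow_natCast]
    push_cast
    rw [h1, hk, zpow_add₀ (by norm_num), ← two_mul, zpow_mul, Int.toNat_of_nonneg h2]
    norm_num

end

section
open Finset

/-- triangular number -/
def tri (m : ℤ) : ℤ := m * (m - 1) / 2

theorem two_tri (m : ℤ) : 2 * tri m = m * (m - 1) := by
  unfold tri
  exact Int.mul_ediv_cancel' (even_iff_two_dvd.1 (Int.even_mul_pred_self m))

/-- exponent -/
def Eg (α β : ℕ) (m : ℤ) : ℤ := (α + β) * tri m + α * m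

theorem Eg_neg (α β : ℕ) (m : ℤ) : Eg β α (-m) = Eg α β m := by
  have h1 := two_tri m
  have h2 := two_tri (-m)
  have : ∀ x y : ℤ, 2 * x = 2 * y → x = y := by intro x y h; omega
  apply this
  unfold Eg
  linear_combination (α + β) * h2 - (α + β) * h1

theorem Eg_succ (α β : ℕ) (m : ℤ) : Eg α β (m + 1) = Eg α β m + ((α + β) * m + α) := by
  have h1 := two_tri m
  have h2 := two_tri (m + 1)
  have : ∀ x y : ℤ, 2 * x = 2 * y → x = y := by intro x y h; omega
  apply this
  unfold Eg
  linear_combination (α + β) * h2 - (α + β) * h1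

theorem Eg_ge {α β : ℕ} (hα : 1 ≤ α) (hβ : 1 ≤ β) (m : ℤ) : |m| ≤ Eg α β m := by
  have h1 := two_tri m
  have hα' : (1 : ℤ) ≤ α := by exact_mod_cast hα
  have hβ' : (1 : ℤ) ≤ β := by exact_mod_cast hβ
  have key : 2 * |m| ≤ 2 * Eg α β m := by
    have e : 2 * Eg α β m = (α + β) * (m * (m - 1)) + 2 * α * m := by
      unfold Eg; linear_combination (α + β) * h1
    rw [e]
    rcases le_or_gt 0 m with hm | hm
    · rw [abs_of_nonneg hm]
      have : 0 ≤ m * (m - 1) := by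
        rcases hm.eq_or_lt with h0 | h0
        · rw [← h0]; simp
        · exact mul_nonneg hm (by omega)
      nlinarith
    · rw [abs_of_neg hm]
      have : 0 ≤ m * (m + 1) := by nlinarith [mul_nonneg (show 0 ≤ -m by omega) (show 0 ≤ -m - 1 by omega)]
      nlinarith
  omega

theorem EE_eq {t r : ℕ} (hr : r < t) (m : ℤ) : EE t r m = Eg (2 * r + 1) (2 * (t - 1 - r) + 1) m := by
  have h1 := two_tri m
  have e : ((t - 1 - r : ℕ) : ℤ) = t - 1 - r := by omega
  unfold EE Eg
  push_cast [e]
  linear_combination -t * h1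

section
variable {A : Type*} [CommRing A] (x : A)

/-- finite product -/
def qq (m n : ℕ) : A := ∏ k ∈ range n, (1 - x ^ (m * (k + 1)))
/-- inverse -/
noncomputable def ii (m n : ℕ) : A := Ring.inverse (qq x m n)

variable {x} {D : ℕ}

theorem unit_one_sub (hx : x ^ D = 0) {j : ℕ} (hj : 0 < j) : IsUnit (1 - x ^ j) := by
  apply IsNilpotent.isUnit_one_sub
  exact IsNilpotent.pow_of_pos ⟨D, hx⟩ hj.ne'

theorem unit_qq (hx : x ^ D = 0) {m : ℕ} (hm : 0 < m) (n : ℕ) : IsUnit (qq x m n) := by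
  unfold qq
  exact IsUnit.prod_iff.2 fun k _ => unit_one_sub hx (by positivity)

theorem qq_ii (hx : x ^ D = 0) {m : ℕ} (hm : 0 < m) (n : ℕ) : qq x m n * ii x m n = 1 :=
  Ring.mul_inverse_cancel _ (unit_qq hx hm n)

theorem qq_succ (m n : ℕ) : qq x m (n + 1) = qq x m n * (1 - x ^ (m * (n + 1))) := by
  rw [qq, prod_range_succ, ← qq]

theorem ii_succ (hx : x ^ D = 0) {m : ℕ} (hm : 0 < m) (n : ℕ) :
    (1 - x ^ (m * (n + 1))) * ii x m (n + 1) = ii x m n := by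
  apply (unit_qq hx hm n).mul_left_cancel
  rw [qq_ii hx hm, ← mul_assoc, ← qq_succ, qq_ii hx hm]

variable (x) in
/-- finite theta sum -/
noncomputable def SF (α β a b : ℕ) : A := ∑ k ∈ range (a + b + 1),
  (-1) ^ (k + b) * ii x (α + β) (a + b - k) * ii x (α + β) k * x ^ (Eg α β ((k : ℤ) - b)).toNat

theorem SF_symm (α β a b : ℕ) : SF x α β a b = SF x β α b a := by
  unfold SF
  rw [← sum_range_reflect, add_comm b a, add_comm β α]
  refine sum_congr rfl fun k hk => ?_
  rw [mem_range] at hk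
  rw [show a + b + 1 - 1 - k = a + b - k by omega, show a + b - (a + b - k) = k by omega]
  have e : ((a + b - k : ℕ) : ℤ) - b = -((k : ℤ) - a) := by omega
  rw [e, Eg_neg]
  have e2 : (-1 : A) ^ (a + b - k + b) = (-1) ^ (k + a) := by
    rw [neg_one_pow_eq_pow_mod_two, neg_one_pow_eq_pow_mod_two (n := k + a)]
    congr 1; omega
  rw [e2]; ring

theorem SF_step (hx : x ^ D = 0) {α β : ℕ} (hα : 1 ≤ α) (hβ : 1 ≤ β) (a b : ℕ) :
    (1 - x ^ ((α + β) * (a + b + 1))) * SF x α β (a + 1) b =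
      (1 - x ^ ((α + β) * a + α)) * SF x α β a b := by
  have hp : 0 < α + β := by omega
  set p := α + β with hpdef
  -- first and second part
  let g : ℕ → A := fun k => (-1) ^ (k + b) * x ^ (Eg α β ((k : ℤ) - b)).toNat
  have hS : SF x α β (a + 1) b = ∑ k ∈ range (a + b + 2), g k * (ii x p (a + b + 1 - k) * ii x p k) := by
    unfold SF
    rw [show a + 1 + b + 1 = a + b + 2 by ring]
    refine sum_congr rfl fun k _ => ?_
    rw [show a + 1 + b - k = a + b + 1 - k by omega]
    simp only [g, hpdef]; ring
  have hS' : SF x α β a b = ∑ k ∈ range (a + b + 1), g k * (ii x p (a + b - k) * ii x p k) := by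
    unfold SF
    refine sum_congr rfl fun k _ => ?_
    simp only [g, hpdef]; ring
  let G : ℕ → A := fun k => if k ≤ a + b then g k * (ii x p (a + b - k) * ii x p k) else 0
  let H : ℕ → A := fun k => if 1 ≤ k then
    g k * (x ^ (p * (a + b + 1 - k)) * ii x p (a + b + 1 - k) * ii x p (k - 1)) else 0
  have hGH : ∀ k ∈ range (a + b + 2), (1 - x ^ (p * (a + b + 1))) *
      (g k * (ii x p (a + b + 1 - k) * ii x p k)) = G k + H k := by
    intro k hk
    rw [mem_range] at hk
    have e : x ^ (p * (a + b + 1)) = x ^ (p * (a + b + 1 - k)) * x ^ (p * k) := by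
      rw [← pow_add, ← mul_add]; congr 2; omega
    have h1 : (1 - x ^ (p * (a + b + 1 - k))) * ii x p (a + b + 1 - k) =
        if k ≤ a + b then ii x p (a + b - k) else 0 := by
      split_ifs with h
      · rw [show a + b + 1 - k = a + b - k + 1 by omega, ii_succ hx hp]
      · rw [show a + b + 1 - k = 0 by omega]; simp
    have h2 : (1 - x ^ (p * k)) * ii x p k = if 1 ≤ k then ii x p (k - 1) else 0 := by
      split_ifs with h
      · obtain ⟨l, rfl⟩ : ∃ l, k = l + 1 := ⟨k - 1, by omega⟩
        rw [ii_succ hx hp]; rfl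
      · rw [show k = 0 by omega]; simp
    have h3 : G k = g k * ((if k ≤ a + b then ii x p (a + b - k) else 0) * ii x p k) := by
      simp only [G]; split_ifs <;> simp
    have h4 : H k = g k * (x ^ (p * (a + b + 1 - k)) * ii x p (a + b + 1 - k) *
        (if 1 ≤ k then ii x p (k - 1) else 0)) := by
      simp only [H]; split_ifs <;> simp
    rw [h3, h4, ← h1, ← h2, e]; ring
  rw [hS, mul_sum, sum_congr rfl hGH, sum_add_distrib, sum_range_succ, sum_range_succ' H]
  have hG0 : G (a + b + 1) = 0 := by simp [G]
  have hH0 : H 0 = 0 := by simp [H]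
  rw [hG0, hH0, add_zero, add_zero, sub_mul, one_mul, hS', sub_eq_add_neg]
  congr 1
  · refine sum_congr rfl fun k hk => ?_
    rw [mem_range] at hk
    simp only [G, show k ≤ a + b by omega, if_true]
  · rw [mul_sum, ← sum_neg_distrib]
    refine sum_congr rfl fun k hk => ?_
    rw [mem_range] at hk
    simp only [H, show 1 ≤ k + 1 by omega, if_true]
    rw [show a + b + 1 - (k + 1) = a + b - k by omega, Nat.add_sub_cancel]
    have e : g (k + 1) * x ^ (p * (a + b - k)) = -(x ^ (p * a + α) * g k) := by
      simp only [g]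
      have e1 := Eg_succ α β ((k : ℤ) - b)
      have e2 := Eg_ge hα hβ ((k : ℤ) - b)
      have e3 := Eg_ge hα hβ ((k : ℤ) - b + 1)
      have e4 : ((k + 1 : ℕ) : ℤ) - b = (k : ℤ) - b + 1 := by push_cast; ring
      have e5 : (Eg α β ((k : ℤ) - b + 1)).toNat + p * (a + b - k) =
          p * a + α + (Eg α β ((k : ℤ) - b)).toNat := by
        zify
        rw [Int.toNat_of_nonneg ((abs_nonneg _).trans e2), Int.toNat_of_nonneg ((abs_nonneg _).trans e3),
          e1, Nat.cast_sub (by omega), hpdef]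
        push_cast; ring
      rw [e4, mul_assoc, ← pow_add, e5, pow_add x (p * a + α)]
      ring
    linear_combination (ii x p (a + b - k) * ii x p k) * e

theorem jfin (hx : x ^ D = 0) {α β : ℕ} (hα : 1 ≤ α) (hβ : 1 ≤ β) (a b : ℕ) :
    (∏ k ∈ range a, (1 - x ^ ((α + β) * k + α))) * (∏ k ∈ range b, (1 - x ^ ((α + β) * k + β))) =
      qq x (α + β) (a + b) * SF x α β a b := by
  induction a with
  | succ a ih =>
    rw [prod_range_succ, show a + 1 + b = a + b + 1 by ring, qq_succ]
    have := SF_step hx hα hβ a b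
    linear_combination (1 - x ^ ((α + β) * a + α)) * ih - qq x (α + β) (a + b) * this
  | zero =>
    induction b with
    | zero =>
      have h1 : Eg α β 0 = 0 := by simp [Eg, tri]
      simp [SF, qq, ii, h1]
    | succ b ih =>
      rw [prod_range_succ, show 0 + (b + 1) = 0 + b + 1 by ring, qq_succ, mul_assoc, SF_symm]
      have := SF_step hx hβ hα b 0
      rw [SF_symm β α b 0] at this
      rw [show 0 + b + 1 = b + 0 + 1 by ring, add_comm α β, this]
      rw [add_comm α β] at ih
      linear_combination (1 - x ^ ((β + α) * b + β)) * ih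

theorem qq_stab (hx : x ^ D = 0) {m : ℕ} (hm : 0 < m) {n : ℕ} (hn : D ≤ n) : qq x m n = qq x m D := by
  induction n, hn using Nat.le_induction with
  | base => rfl
  | succ n hn ih =>
    rw [qq_succ, ih, pow_eq_zero_of_le _ hx, sub_zero, mul_one]
    nlinarith

theorem jtp (hx : x ^ D = 0) {α β : ℕ} (hα : 1 ≤ α) (hβ : 1 ≤ β) {n : ℕ} (hn : 2 * D ≤ n) :
    qq x (α + β) D * ((∏ k ∈ range n, (1 - x ^ ((α + β) * k + α))) *
      (∏ k ∈ range n, (1 - x ^ ((α + β) * k + β)))) =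
      ∑ m ∈ Icc (-(n : ℤ)) n, (-1) ^ m.natAbs * x ^ (Eg α β m).toNat := by
  have hp : 0 < α + β := by omega
  rw [jfin hx hα hβ, SF, mul_sum, mul_sum]
  refine sum_bij' (fun k _ => (k : ℤ) - n) (fun m _ => (m + n).toNat) ?_ ?_ ?_ ?_ ?_
  · intro k hk; rw [mem_range] at hk; rw [mem_Icc]; omega
  · intro k hk; rw [mem_Icc] at hk; rw [mem_range]; omega
  · intro k _; simp
  · intro m hm; rw [mem_Icc] at hm; omega
  · intro k hk
    rw [mem_range] at hk
    have hE := Eg_ge hα hβ ((k : ℤ) - n)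
    by_cases hbig : (D : ℤ) ≤ |(k : ℤ) - n|
    · rw [pow_eq_zero_of_le (m := D) (by omega) hx]; simp
    · rw [not_le, abs_lt] at hbig
      have e1 : ii x (α + β) (n + n - k) = ii x (α + β) D := by
        rw [ii, qq_stab hx hp (by omega), ← ii]
      have e2 : ii x (α + β) k = ii x (α + β) D := by
        rw [ii, qq_stab hx hp (by omega), ← ii]
      have e0 : qq x (α + β) (n + n) = qq x (α + β) D := qq_stab hx hp (by omega)
      rw [e1, e2, e0]
      have e3 : (-1 : A) ^ (k + n) = (-1) ^ ((k : ℤ) - n).natAbs := by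
        rw [neg_one_pow_eq_pow_mod_two, neg_one_pow_eq_pow_mod_two (n := ((k : ℤ) - n).natAbs)]
        congr 1; omega
      rw [e3]
      have := qq_ii hx hp D
      linear_combination ((-1) ^ ((k : ℤ) - n).natAbs * x ^ (Eg α β ((k : ℤ) - n)).toNat *
        (qq x (α + β) D * ii x (α + β) D + 1)) * this

end

end

section
open Finset

section
variable {A : Type*} [CommRing A] {x : A} {D : ℕ}

variable (x) in
/-- odd residue product -/
def RR (t n i : ℕ) : A := ∏ k ∈ range n, (1 - x ^ (2 * t * k + (2 * i + 1)))

theorem prod_block (f : ℕ → A) (p n : ℕ) :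
    ∏ k ∈ range (p * n), f k = ∏ i ∈ range p, ∏ k ∈ range n, f (p * k + i) := by
  rw [prod_comm]
  induction n with
  | zero => simp
  | succ n ih => rw [mul_add, mul_one, prod_range_add, ih, prod_range_succ]

theorem prod_two (f : ℕ → A) (n : ℕ) :
    ∏ k ∈ range (2 * n), f k = (∏ k ∈ range n, f (2 * k)) * ∏ k ∈ range n, f (2 * k + 1) := by
  rw [prod_block, prod_range_succ, prod_range_one]; rfl

theorem qq_two (m n : ℕ) : qq x m (2 * n) = qq x (2 * m) n * ∏ k ∈ range n, (1 - x ^ (m * (2 * k + 1))) := by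
  unfold qq
  rw [prod_two, mul_comm]
  congr 1
  refine prod_congr rfl fun k _ => ?_
  congr 2; ring

theorem Q1_eq (hx : x ^ D = 0) {t n : ℕ} (ht : 0 < t) (hn : D ≤ n) :
    qq x 1 D = qq x 2 D * ∏ i ∈ range t, RR x t n i := by
  have h1 : D ≤ t * n := by nlinarith
  rw [← qq_stab hx one_pos (show D ≤ 2 * (t * n) by omega), qq_two,
    qq_stab hx (by norm_num) h1, prod_block]
  congr 1
  refine prod_congr rfl fun i _ => prod_congr rfl fun k _ => ?_
  congr 2; ring

theorem Qt_eq (hx : x ^ D = 0) {t' n : ℕ} (hn : D ≤ n) :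
    qq x (2 * t' + 1) D = qq x (2 * (2 * t' + 1)) D * RR x (2 * t' + 1) n t' := by
  rw [← qq_stab hx (by omega) (show D ≤ 2 * n by omega), qq_two, qq_stab hx (by omega) hn]
  congr 1
  refine prod_congr rfl fun k _ => ?_
  congr 2; ring

variable (x) in
/-- theta -/
noncomputable def Th (t n r : ℕ) : A := ∑ m ∈ Icc (-(n : ℤ)) n, (-1) ^ m.natAbs * x ^ (EE t r m).toNat

theorem Th_eq (hx : x ^ D = 0) {t n r : ℕ} (hr : r < t) (hn : 2 * D ≤ n) :
    Th x t n r = qq x (2 * t) D * (RR x t n r * RR x t n (t - 1 - r)) := by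
  have := jtp hx (α := 2 * r + 1) (β := 2 * (t - 1 - r) + 1) (by omega) (by omega) hn
  rw [show 2 * r + 1 + (2 * (t - 1 - r) + 1) = 2 * t by omega] at this
  unfold Th RR
  rw [this]
  refine sum_congr rfl fun m _ => ?_
  rw [EE_eq hr]

theorem prod_odd (f : ℕ → A) (t' : ℕ) :
    ∏ i ∈ range (2 * t' + 1), f i = (∏ r ∈ range t', (f r * f (2 * t' + 1 - 1 - r))) * f t' := by
  rw [show 2 * t' + 1 = t' + 1 + t' by ring, prod_range_add, prod_range_succ, prod_mul_distrib,
    ← prod_range_reflect (fun r => f (t' + 1 + r))]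
  have : ∏ j ∈ range t', f (t' + 1 + (t' - 1 - j)) = ∏ r ∈ range t', f (t' + 1 + t' - 1 - r) :=
    prod_congr rfl fun j hj => by
      rw [mem_range] at hj
      congr 1; omega
  rw [this]; ring

theorem G_eq (hx : x ^ D = 0) {t' n : ℕ} (hn : 2 * D ≤ n) {G : A}
    (hG : G * (qq x 2 D * qq x (2 * t' + 1) D) = qq x 1 D * qq x (2 * (2 * t' + 1)) D ^ (t' + 1)) :
    G = ∏ r : Fin t', Th x (2 * t' + 1) n r := by
  have h1 : ∏ r : Fin t', Th x (2 * t' + 1) n r = ∏ r ∈ range t', Th x (2 * t' + 1) n r :=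
    Fin.prod_univ_eq_prod_range (fun r => Th x (2 * t' + 1) n r) t'
  have h2 : ∏ r ∈ range t', Th x (2 * t' + 1) n r = qq x (2 * (2 * t' + 1)) D ^ t' *
      ∏ r ∈ range t', (RR x (2 * t' + 1) n r * RR x (2 * t' + 1) n (2 * t' + 1 - 1 - r)) := by
    rw [prod_congr rfl fun r hr => Th_eq hx (show r < 2 * t' + 1 by rw [mem_range] at hr; omega) hn,
      prod_mul_distrib, prod_const, card_range]
  apply ((unit_qq hx (show 0 < 2 by norm_num) D).mul
    (unit_qq hx (show 0 < 2 * t' + 1 by omega) D)).mul_right_cancel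
  rw [hG, h1, h2, Q1_eq hx (show 0 < 2 * t' + 1 by omega) (show D ≤ n by omega),
    Qt_eq hx (show D ≤ n by omega), prod_odd]
  ring

end

theorem EE_parity (t' : ℕ) (r : ℕ) (m : ℤ) : Even (EE (2 * t' + 1) r m + m) := by
  unfold EE
  have : Even (m * (m + 1)) := Int.even_mul_succ_self m
  obtain ⟨k, hk⟩ := this
  refine ⟨t' * m ^ 2 + k + (r - t') * m, ?_⟩
  push_cast
  linear_combination hk

open PowerSeries in
theorem coeff_Th (K t' d : ℕ) :
    PowerSeries.coeff d (∏ r : Fin t', Th (X : PowerSeries ℂ) (2 * t' + 1) K r) =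
    ∑ f ∈ Fintype.piFinset (fun _ : Fin t' => Icc (-(K:ℤ)) K),
      if ∑ r : Fin t', EE (2*t'+1) r (f r) = d then (-1 : ℂ) ^ (d : ℤ).toNat else 0 := by
  unfold Th
  rw [prod_univ_sum, map_sum]
  refine sum_congr rfl fun f _ => ?_
  have h0 : ∀ r : Fin t', 0 ≤ EE (2 * t' + 1) r (f r) := fun r => EE_nonneg (by omega) _
  have e1 : ∀ r : Fin t', (-1 : PowerSeries ℂ) ^ (f r).natAbs * X ^ (EE (2 * t' + 1) r (f r)).toNat =
      PowerSeries.C ((-1) ^ (EE (2 * t' + 1) r (f r)).toNat) * X ^ (EE (2 * t' + 1) r (f r)).toNat := by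
    intro r
    have := EE_parity t' r (f r)
    have h := h0 r
    congr 1
    rw [map_pow, map_neg, map_one, neg_one_pow_eq_pow_mod_two,
      neg_one_pow_eq_pow_mod_two (n := (EE (2 * t' + 1) r (f r)).toNat)]
    congr 1
    obtain ⟨k, hk⟩ := this
    omega
  rw [prod_congr rfl fun r _ => e1 r, prod_mul_distrib, ← map_prod, prod_pow_eq_pow_sum, prod_pow_eq_pow_sum,
    PowerSeries.coeff_C_mul, PowerSeries.coeff_X_pow]
  have e2 : ((∑ r : Fin t', (EE (2 * t' + 1) r (f r)).toNat : ℕ) : ℤ) = ∑ r : Fin t', EE (2 * t' + 1) r (f r) := by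
    push_cast
    exact sum_congr rfl fun r _ => Int.toNat_of_nonneg (h0 r)
  rw [← e2]
  norm_cast
  by_cases h : ∑ r : Fin t', (EE (2 * t' + 1) r (f r)).toNat = d
  · simp [h]
  · simp [h, Ne.symm h]

end

section
open Finset
open PowerSeries

theorem hasSum_ps {ι : Type*} {f : ι → PowerSeries ℂ} {g : PowerSeries ℂ}
    (h : ∀ d, HasSum (fun i => PowerSeries.coeff d (f i)) (PowerSeries.coeff d g)) : HasSum f g :=
  (PowerSeries.WithPiTopology.hasSum_iff_hasSum_coeff (f := f)).2 h

theorem t2_ps : T2Space (PowerSeries ℂ) := PowerSeries.WithPiTopology.instT2Space ℂ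

theorem hasProd_ps {f : ℕ → PowerSeries ℂ} {g : PowerSeries ℂ}
    (h : ∀ d, ∀ s : Finset ℕ, range (d + 1) ⊆ s →
      PowerSeries.coeff d (∏ i ∈ s, f i) = PowerSeries.coeff d g) : HasProd f g := by
  refine (PowerSeries.WithPiTopology.tendsto_iff_coeff_tendsto _ _ _ _).2 fun d => ?_
  refine tendsto_const_nhds.congr' ?_
  rw [SummationFilter.unconditional_filter]
  filter_upwards [Filter.eventually_ge_atTop (range (d + 1))] with s hs
  exact (h d s hs).symm

/-- quotient map -/
noncomputable abbrev pm (D : ℕ) : PowerSeries ℂ →+* PowerSeries ℂ ⧸ Ideal.span {(X : PowerSeries ℂ) ^ D} :=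
  Ideal.Quotient.mk _

theorem pm_coeff {D d : ℕ} (hd : d < D) {u v : PowerSeries ℂ} (h : pm D u = pm D v) :
    PowerSeries.coeff d u = PowerSeries.coeff d v := by
  rw [Ideal.Quotient.eq, Ideal.mem_span_singleton, X_pow_dvd_iff] at h
  have := h d hd
  rwa [map_sub, sub_eq_zero] at this

theorem pm_X (D : ℕ) : (pm D X) ^ D = 0 := by
  rw [← map_pow, Ideal.Quotient.eq_zero_iff_mem]
  exact Ideal.mem_span_singleton_self _

/-- factor -/
noncomputable def gg (t' k : ℕ) : PowerSeries ℂ :=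
  ((1 - X ^ (k + 1)) * (1 - X ^ (2 * (k + 1)) : PowerSeries ℂ)⁻¹ *
          (1 - X ^ (2 * (k + 1) * (2 * t' + 1))) ^ t' *
          ((1 - X ^ (2 * (k + 1) * (2 * t' + 1))) *
            (1 - X ^ ((k + 1) * (2 * t' + 1)) : PowerSeries ℂ)⁻¹))

theorem inv_ps {j : ℕ} (hj : 0 < j) : (1 - X ^ j : PowerSeries ℂ) * (1 - X ^ j : PowerSeries ℂ)⁻¹ = 1 := by
  apply PowerSeries.mul_inv_cancel
  simp [hj.ne']

theorem gg_mul (t' k : ℕ) : gg t' k * ((1 - X ^ (2 * (k + 1))) * (1 - X ^ ((2 * t' + 1) * (k + 1)))) =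
    (1 - X ^ (1 * (k + 1))) * (1 - X ^ (2 * (2 * t' + 1) * (k + 1))) ^ (t' + 1) := by
  have h1 := inv_ps (j := 2 * (k + 1)) (by omega)
  have h2 := inv_ps (j := (k + 1) * (2 * t' + 1)) (by positivity)
  unfold gg
  rw [show 2 * (k + 1) * (2 * t' + 1) = 2 * (2 * t' + 1) * (k + 1) by ring, mul_comm (2 * t' + 1) (k + 1),
    one_mul]
  generalize (1 - X ^ (2 * (k + 1)) : PowerSeries ℂ)⁻¹ = u at *
  generalize (1 - X ^ ((k + 1) * (2 * t' + 1)) : PowerSeries ℂ)⁻¹ = v at *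
  generalize (1 - X ^ (2 * (k + 1)) : PowerSeries ℂ) = u' at *
  generalize (1 - X ^ ((k + 1) * (2 * t' + 1)) : PowerSeries ℂ) = v' at *
  generalize (1 - X ^ (2 * (2 * t' + 1) * (k + 1)) : PowerSeries ℂ) = w at *
  generalize (1 - X ^ (k + 1) : PowerSeries ℂ) = z at *
  linear_combination (z * w ^ t' * w * (v' * v)) * h1 + z * w ^ t' * w * h2

theorem pm_gg {D k : ℕ} (t' : ℕ) (hk : D ≤ k + 1) : pm D (gg t' k) = 1 := by
  have h0 : ∀ j, D ≤ j → pm D (1 - X ^ j) = 1 := fun j hj => by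
    rw [map_sub, map_pow, pow_eq_zero_of_le hj (pm_X D), map_one, sub_zero]
  have := congrArg (pm D) (gg_mul t' k)
  simp only [map_mul, map_pow] at this
  rw [h0 _ (by omega), h0 _ (by nlinarith), h0 _ (by omega), h0 _ (by nlinarith)] at this
  simpa using this

theorem pm_prod {D : ℕ} (t' : ℕ) {s : Finset ℕ} (hs : range D ⊆ s) :
    pm D (∏ k ∈ s, gg t' k) = pm D (∏ k ∈ range D, gg t' k) := by
  rw [map_prod, map_prod]
  symm
  refine prod_subset hs fun k _ hk => pm_gg t' ?_
  rw [mem_range] at hk; omega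

theorem pm_qq (D m n : ℕ) : pm D (qq X m n) = qq (pm D X) m n := by
  unfold qq; simp

theorem pm_Th (D t n r : ℕ) : pm D (Th X t n r) = Th (pm D X) t n r := by
  unfold Th; simp

theorem prod_gg (t' D n : ℕ) (hn : 2 * D ≤ n) :
    pm D (∏ k ∈ range D, gg t' k) = pm D (∏ r : Fin t', Th X (2 * t' + 1) n r) := by
  rw [map_prod (pm D) (fun r : Fin t' => Th X (2 * t' + 1) n r), prod_congr rfl fun r _ => pm_Th D _ n _]
  apply G_eq (pm_X D) hn
  simp only [← pm_qq, ← map_mul, ← map_pow]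
  congr 1
  unfold qq
  rw [← prod_mul_distrib, ← prod_mul_distrib, ← prod_pow, ← prod_mul_distrib]
  exact prod_congr rfl fun k _ => gg_mul t' k

/-- infinite product -/
noncomputable def PP (t' : ℕ) : PowerSeries ℂ :=
  PowerSeries.mk fun d => PowerSeries.coeff d (∏ k ∈ range (d + 1), gg t' k)

theorem hasProd_gg (t' : ℕ) : HasProd (gg t') (PP t') := by
  refine hasProd_ps fun d s hs => ?_
  rw [PP, coeff_mk]
  exact pm_coeff (Nat.lt_succ_self d) (pm_prod t' hs)

theorem coeff_PP (t' d n : ℕ) (hn : 2 * (d + 1) ≤ n) (hb : Even (b0 ((2 * t' + 1) * n))) :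
    PowerSeries.coeff d (PP t') = TT ((2 * t' + 1) * n) (2 * t' + 1) (d + b0 ((2 * t' + 1) * n)) 0 := by
  rw [PP, coeff_mk, pm_coeff (Nat.lt_succ_self d) (prod_gg t' (d + 1) n hn), coeff_Th, TT_core n t' hb]

/-! exponential -/

theorem ode_unique {S Y g : PowerSeries ℂ} (h0 : PowerSeries.coeff 0 S = PowerSeries.coeff 0 Y)
    (hS : PowerSeries.derivative ℂ S = S * g) (hY : PowerSeries.derivative ℂ Y = Y * g) : S = Y := by
  ext n
  induction n using Nat.strong_induction_on with
  | _ n ih =>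
    cases n with
    | zero => exact h0
    | succ n =>
      have h1 := congrArg (PowerSeries.coeff n) hS
      have h2 := congrArg (PowerSeries.coeff n) hY
      rw [PowerSeries.coeff_derivative, PowerSeries.coeff_mul] at h1 h2
      have hne : ((n : ℂ) + 1) ≠ 0 := by exact_mod_cast Nat.succ_ne_zero n
      apply mul_right_cancel₀ hne
      rw [h1, h2]
      refine sum_congr rfl fun p hp => ?_
      rw [HasAntidiagonal.mem_antidiagonal] at hp
      rw [ih p.1 (by omega)]

/-- partial exponential -/
noncomputable def EM (f : PowerSeries ℂ) (M : ℕ) : PowerSeries ℂ :=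
  ∑ k ∈ range M, PowerSeries.C ((k.factorial : ℂ))⁻¹ * f ^ k

theorem coeff_fk {f : PowerSeries ℂ} (hf : X ∣ f) {n k : ℕ} (h : n < k) :
    PowerSeries.coeff n (PowerSeries.C ((k.factorial : ℂ))⁻¹ * f ^ k) = 0 := by
  have h1 : (X : PowerSeries ℂ) ^ k ∣ f ^ k := pow_dvd_pow_of_dvd hf k
  rw [PowerSeries.coeff_C_mul, X_pow_dvd_iff.1 h1 n h, mul_zero]

theorem coeff_EM {f : PowerSeries ℂ} (hf : X ∣ f) {n M : ℕ} (h : n < M) :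
    PowerSeries.coeff n (EM f M) = PowerSeries.coeff n (EM f (n + 1)) := by
  unfold EM
  rw [map_sum, map_sum]
  symm
  refine sum_subset (range_subset_range.2 h) fun k _ hk => coeff_fk hf ?_
  rw [mem_range] at hk; omega

/-- full exponential -/
noncomputable def EX (f : PowerSeries ℂ) : PowerSeries ℂ :=
  PowerSeries.mk fun n => PowerSeries.coeff n (EM f (n + 1))

theorem pexp_eq {f : PowerSeries ℂ} (hf : X ∣ f) : pexp f = EX f := by
  have := t2_ps
  unfold pexp
  refine HasSum.tsum_eq (hasSum_ps fun d => ?_)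
  rw [EX, coeff_mk, EM, map_sum]
  refine hasSum_sum_of_ne_finset_zero fun k hk => coeff_fk hf ?_
  rw [mem_range] at hk; omega

theorem deriv_EM (f : PowerSeries ℂ) (M : ℕ) :
    PowerSeries.derivative ℂ (EM f (M + 1)) = EM f M * PowerSeries.derivative ℂ f := by
  unfold EM
  rw [map_sum, sum_range_succ', sum_mul]
  have h0 : PowerSeries.derivative ℂ (PowerSeries.C ((Nat.factorial 0 : ℂ))⁻¹ * f ^ 0) = 0 := by
    rw [pow_zero, mul_one]; simp
  rw [h0, add_zero]
  refine sum_congr rfl fun k _ => ?_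
  rw [← PowerSeries.smul_eq_C_mul, Derivation.map_smul, Derivation.leibniz_pow, PowerSeries.smul_eq_C_mul]
  have : PowerSeries.C (((k + 1).factorial : ℂ))⁻¹ * ((k + 1 : ℕ) : PowerSeries ℂ) = PowerSeries.C ((k.factorial : ℂ))⁻¹ := by
    rw [← map_natCast (PowerSeries.C (R := ℂ)), ← map_mul]
    congr 1
    have h1 : ((k + 1 : ℕ) : ℂ) ≠ 0 := by exact_mod_cast Nat.succ_ne_zero k
    rw [Nat.factorial_succ, Nat.cast_mul, mul_inv, mul_comm, ← mul_assoc, mul_inv_cancel₀ h1, one_mul]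
  rw [← this]
  simp only [nsmul_eq_mul, smul_eq_mul, Nat.add_sub_cancel]
  ring

theorem deriv_EX {f : PowerSeries ℂ} (hf : X ∣ f) :
    PowerSeries.derivative ℂ (EX f) = EX f * PowerSeries.derivative ℂ f := by
  ext n
  have h := congrArg (PowerSeries.coeff n) (deriv_EM f (n + 1))
  rw [PowerSeries.coeff_derivative] at h ⊢
  rw [EX, coeff_mk, h, PowerSeries.coeff_mul, PowerSeries.coeff_mul]
  refine sum_congr rfl fun p hp => ?_
  rw [HasAntidiagonal.mem_antidiagonal] at hp
  rw [coeff_mk, coeff_EM hf (by omega)]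

/-- explicit exponential -/
noncomputable def Yexp (t : ℕ) (b : ℂ) : PowerSeries ℂ :=
  PowerSeries.mk fun n => if t ∣ n then (Complex.I * b) ^ (n / t) * ee t (n / t) else 0

theorem coeff_YY_mul {t : ℕ} (ht : 0 < t) (b : ℂ) (m : ℕ) :
    PowerSeries.coeff (t * m) (Yexp t b) = (Complex.I * b) ^ m * ee t m := by
  rw [Yexp, coeff_mk, if_pos (dvd_mul_right _ _), Nat.mul_div_cancel_left _ ht]

theorem coeff_YY_ndvd {t : ℕ} (b : ℂ) {n : ℕ} (h : ¬ t ∣ n) :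
    PowerSeries.coeff n (Yexp t b) = 0 := by
  rw [Yexp, coeff_mk, if_neg h]

/-- exponent series -/
noncomputable def fF (t : ℕ) (b : ℂ) : PowerSeries ℂ :=
  - (PowerSeries.C b * X ^ t) - PowerSeries.C ((t : ℂ) * b ^ 2 / 2) * X ^ (2 * t)

theorem deriv_fF (t : ℕ) (b : ℂ) : PowerSeries.derivative ℂ (fF t b) =
    -(PowerSeries.C (b * t) * X ^ (t - 1)) - PowerSeries.C ((t : ℂ) ^ 2 * b ^ 2) * X ^ (2 * t - 1) := by
  unfold fF
  simp only [map_sub, map_neg, ← PowerSeries.smul_eq_C_mul, Derivation.map_smul, Derivation.leibniz_pow,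
    PowerSeries.derivative_X, nsmul_eq_mul, smul_eq_mul, mul_one]
  simp only [PowerSeries.smul_eq_C_mul, ← map_natCast (PowerSeries.C (R := ℂ)), ← mul_assoc, ← map_mul]
  congr 3
  push_cast; ring_nf

theorem deriv_YY {t : ℕ} (ht : 0 < t) (b : ℂ) : PowerSeries.derivative ℂ (Yexp t b) =
    Yexp t b * PowerSeries.derivative ℂ (fF t b) := by
  rw [deriv_fF]
  ext n
  have e : Yexp t b * (-(PowerSeries.C (b * t) * X ^ (t - 1)) - PowerSeries.C ((t : ℂ) ^ 2 * b ^ 2) * X ^ (2 * t - 1))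
    = -(PowerSeries.C (b * t) * (Yexp t b * X ^ (t - 1))) - PowerSeries.C ((t : ℂ) ^ 2 * b ^ 2) * (Yexp t b * X ^ (2 * t - 1)) := by
    ring
  rw [e, PowerSeries.coeff_derivative, map_sub, map_neg, PowerSeries.coeff_C_mul, PowerSeries.coeff_C_mul,
    PowerSeries.coeff_mul_X_pow', PowerSeries.coeff_mul_X_pow']
  by_cases hd : t ∣ n + 1
  · obtain ⟨m, hm⟩ := hd
    have hI : Complex.I ^ 2 = -1 := Complex.I_sq
    have hn : (n : ℂ) + 1 = t * m := by exact_mod_cast hm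
    rw [hm, coeff_YY_mul ht, hn]
    rcases m with _ | _ | m
    · simp at hm
    · have h1 : t - 1 ≤ n := by omega
      have h2 : ¬ (2 * t - 1 ≤ n) := by omega
      rw [if_pos h1, if_neg h2, show n - (t - 1) = t * 0 by omega, coeff_YY_mul ht]
      simp only [ee, zero_add, pow_one, pow_zero]
      push_cast
      linear_combination b * t * hI
    · have h0 : t * (m + 1 + 1) = t * m + t + t := by ring
      have h1 : t - 1 ≤ n := by omega
      have h2 : 2 * t - 1 ≤ n := by omega
      have h3 : t * (m + 1) = t * m + t := by ring
      rw [if_pos h1, if_pos h2, show n - (t - 1) = t * (m + 1) by omega, show n - (2 * t - 1) = t * m by omega,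
        coeff_YY_mul ht, coeff_YY_mul ht]
      have h5 : ee t (m + 1 + 1) * (m + 2) = Complex.I * ee t (m + 1) + t * ee t m := by
        rw [ee]
        have : (m : ℂ) + 2 ≠ 0 := by exact_mod_cast Nat.succ_ne_zero (m + 1)
        field_simp
      push_cast
      linear_combination (Complex.I * b) ^ (m + 2) * t * h5 +
        ((Complex.I * b) ^ (m + 1) * t * b * ee t (m + 1) + (Complex.I * b) ^ m * t ^ 2 * b ^ 2 * ee t m) * hI
  · rw [coeff_YY_ndvd b hd]
    have a1 : ¬ (t - 1 ≤ n ∧ t ∣ n - (t - 1)) := by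
      rintro ⟨h1, h2⟩
      apply hd
      have := h2.add (dvd_refl t)
      rwa [show n - (t - 1) + t = n + 1 by omega] at this
    have a2 : ¬ (2 * t - 1 ≤ n ∧ t ∣ n - (2 * t - 1)) := by
      rintro ⟨h1, h2⟩
      apply hd
      have := h2.add (dvd_mul_left t 2)
      rwa [show n - (2 * t - 1) + 2 * t = n + 1 by omega] at this
    have b1 : (if t - 1 ≤ n then PowerSeries.coeff (n - (t - 1)) (Yexp t b) else 0) = 0 := by
      split_ifs with h
      · exact coeff_YY_ndvd b fun h' => a1 ⟨h, h'⟩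
      · rfl
    have b2 : (if 2 * t - 1 ≤ n then PowerSeries.coeff (n - (2 * t - 1)) (Yexp t b) else 0) = 0 := by
      split_ifs with h
      · exact coeff_YY_ndvd b fun h' => a2 ⟨h, h'⟩
      · rfl
    rw [b1, b2]; simp

theorem pexp_fF {t : ℕ} (ht : 0 < t) (b : ℂ) : pexp (fF t b) = Yexp t b := by
  have hf : (X : PowerSeries ℂ) ∣ fF t b := by
    unfold fF
    refine dvd_sub (dvd_neg.2 (Dvd.dvd.mul_left (dvd_pow_self _ ht.ne') _))
      (Dvd.dvd.mul_left (dvd_pow_self _ (by omega)) _)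
  rw [pexp_eq hf]
  refine ode_unique ?_ (deriv_EX hf) (deriv_YY ht b)
  have := coeff_YY_mul ht b 0
  rw [mul_zero] at this
  rw [this, EX, coeff_mk]
  simp [EM, ee]

theorem coeff_YY_PP {t : ℕ} (ht : 0 < t) (b : ℂ) (P : PowerSeries ℂ) (d : ℕ) :
    PowerSeries.coeff d (Yexp t b * P) = ∑ w ∈ range (d + 1),
      (Complex.I * b) ^ w * (if t * w ≤ d then ee t w * PowerSeries.coeff (d - t * w) P else 0) := by
  rw [PowerSeries.coeff_mul, Nat.sum_antidiagonal_eq_sum_range_succ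
    (fun i j => PowerSeries.coeff i (Yexp t b) * PowerSeries.coeff j P)]
  symm
  refine sum_bij_ne_zero (fun w _ _ => t * w) ?_ ?_ ?_ ?_
  · intro w _ h
    rw [mem_range]
    by_contra h'
    rw [if_neg (by omega)] at h
    simp at h
  · intro w _ _ w' _ _ h
    exact Nat.eq_of_mul_eq_mul_left ht h
  · intro n hn h
    rw [mem_range] at hn
    by_cases hd : t ∣ n
    · obtain ⟨w, rfl⟩ := hd
      rw [coeff_YY_mul ht] at h
      refine ⟨w, ?_, ?_, rfl⟩
      · rw [mem_range]; nlinarith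
      · rw [if_pos (by omega), ← mul_assoc]; exact h
    · rw [coeff_YY_ndvd b hd] at h; simp at h
  · intro w _ h
    have : t * w ≤ d := by
      by_contra h'
      rw [if_neg h'] at h
      simp at h
    rw [if_pos this, coeff_YY_mul ht, mul_assoc]

end

section
open Finset
open PowerSeries

theorem b0_even (m : ℕ) : Even (b0 (4 * m)) := by
  unfold b0
  induction m with
  | zero => simp
  | succ m ih =>
    rw [show 4 * (m + 1) = 4 * m + 1 + 1 + 1 + 1 by ring]
    simp only [sum_range_succ]
    obtain ⟨k, hk⟩ := ih
    rw [hk]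
    exact ⟨k + 8 * m + 3, by push_cast; ring⟩

theorem TT_core_neg (K t' : ℕ) (hb : Even (b0 ((2 * t' + 1) * K))) {d : ℤ} (hd : d < 0) :
    TT ((2 * t' + 1) * K) (2 * t' + 1) (d + b0 ((2 * t' + 1) * K)) 0 = 0 := by
  rw [TT_core K t' hb]
  refine sum_eq_zero fun f _ => if_neg fun h => ?_
  have : 0 ≤ ∑ r : Fin t', EE (2 * t' + 1) r (f r) := sum_nonneg fun r _ => EE_nonneg (by omega) _
  omega

theorem final_coeff (t' : ℕ) (b : ℂ) (d K : ℕ) (hK : 2 * (d + 1) ≤ K) (hb : Even (b0 ((2 * t' + 1) * K))) :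
    ∑ w ∈ range (d + 1), (Complex.I * b) ^ w *
      TT ((2 * t' + 1) * K) (2 * t' + 1) (d + b0 ((2 * t' + 1) * K)) w =
    PowerSeries.coeff d (Yexp (2 * t' + 1) b * PP t') := by
  rw [coeff_YY_PP (by omega)]
  refine sum_congr rfl fun w _ => ?_
  congr 1
  have hN : 2 * t' + 1 ≤ (2 * t' + 1) * K := Nat.le_mul_of_pos_right _ (by omega)
  have hKN : K ≤ (2 * t' + 1) * K := Nat.le_mul_of_pos_left _ (by omega)
  rw [TT_eq hN w _ (by zify at hKN hK; push_cast at *; linarith)]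
  split_ifs with h
  · rw [coeff_PP t' (d - (2 * t' + 1) * w) K (by omega) hb]
    congr 2
    rw [Nat.cast_sub h]; push_cast; ring
  · have : (d : ℤ) - (2 * t' + 1) * w < 0 := by
      have : d < (2 * t' + 1) * w := by omega
      zify at this; linarith
    have h2 := TT_core_neg K t' hb this
    have e : (d : ℤ) + b0 ((2 * t' + 1) * K) - (2 * t' + 1) * w =
      (d : ℤ) - (2 * t' + 1) * w + b0 ((2 * t' + 1) * K) := by ring
    rw [e, h2, mul_zero]

theorem lhs_hasSum (t' : ℕ) (b : ℂ) : HasSum (fun μ : {μ : YoungDiagram // μ.transpose = μ} =>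
      PowerSeries.C ((-1) ^ durfee μ.1 *
        ∏ c ∈ μ.1.cells.filter (fun c => (2 * t' + 1) ∣ hookLen μ.1 c),
          (b * (2 * t' + 1 : ℕ) / ((hookLen μ.1 c : ℂ) * eps c))) * X ^ μ.1.card)
      (Yexp (2 * t' + 1) b * PP t') := by
  refine hasSum_ps fun d => ?_
  have hb : Even (b0 ((2 * t' + 1) * (4 * (d + 1)))) := by
    rw [show (2 * t' + 1) * (4 * (d + 1)) = 4 * ((2 * t' + 1) * (d + 1)) by ring]
    exact b0_even _
  rw [← final_coeff t' b d (4 * (d + 1)) (by omega) hb]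
  have hKN : 4 * (d + 1) ≤ (2 * t' + 1) * (4 * (d + 1)) := Nat.le_mul_of_pos_left _ (by omega)
  convert coeff_lhs (show 0 < 2 * t' + 1 by omega) hb b d (by omega) using 1
  funext μ
  rw [PowerSeries.coeff_C_mul, PowerSeries.coeff_X_pow]
  by_cases h : μ.1.card = d
  · simp [h]
  · simp [h, Ne.symm h]

end

theorem exp_genfun_SC_odd (t' : ℕ) (b : ℂ) :
    ∑' μ : {μ : YoungDiagram // μ.transpose = μ},
      PowerSeries.C ((-1) ^ durfee μ.1 *
        ∏ c ∈ μ.1.cells.filter (fun c => (2 * t' + 1) ∣ hookLen μ.1 c),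
          (b * (2 * t' + 1 : ℕ) / ((hookLen μ.1 c : ℂ) * eps c))) * X ^ μ.1.card
      =
    pexp (- (PowerSeries.C b * X ^ (2 * t' + 1)) -
        PowerSeries.C (((2 * t' + 1 : ℕ) : ℂ) * b ^ 2 / 2) * X ^ (2 * (2 * t' + 1))) *
      ∏' k : ℕ,
        ((1 - X ^ (k + 1)) * (1 - X ^ (2 * (k + 1)) : PowerSeries ℂ)⁻¹ *
          (1 - X ^ (2 * (k + 1) * (2 * t' + 1))) ^ t' *
          ((1 - X ^ (2 * (k + 1) * (2 * t' + 1))) *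
            (1 - X ^ ((k + 1) * (2 * t' + 1)) : PowerSeries ℂ)⁻¹)) := by
  have := t2_ps
  rw [(lhs_hasSum t' b).tsum_eq]
  have h1 := pexp_fF (show 0 < 2 * t' + 1 by omega) b
  have h2 := (hasProd_gg t').tprod_eq
  unfold fF at h1
  unfold gg at h2
  rw [h1, h2]
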